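/- arXiv:1209.5866 — 4 statements merged into one kernel-verified Lean document; each statement's English description precedes it below -/
import Mathlib

section
/- Let r > 0 and c ≥ 0. Then every C² function f : B_r → ℝ on the open ball B_r ⊆ ℝ² satisfying f ≥ 0, Δf ≥ -c f² pointwise on B_r, and 8c ∫_{B_r} f < π, also satisfies f(0) ≤ (8/(π r²)) ∫_{B_r} f. -/
open MeasureTheory
open scoped ENNReal

/-- The Laplacian `Δf = ∂²f/∂s² + ∂²f/∂t²` of a function `f : ℝ² → ℝ`. -/
noncomputable def laplacianR2 (f : EuclideanSpace ℝ (Fin 2) → ℝ)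
    (x : EuclideanSpace ℝ (Fin 2)) : ℝ :=
  ∑ i : Fin 2,
    fderiv ℝ (fun y => fderiv ℝ f y (EuclideanSpace.single i (1 : ℝ))) x
      (EuclideanSpace.single i (1 : ℝ))

open Real Set Metric Filter Topology

/-- The unit vector of `ℝ²` at angle `θ`. -/
noncomputable def angleVec (θ : ℝ) : EuclideanSpace ℝ (Fin 2) :=
  cos θ • EuclideanSpace.single 0 1 + sin θ • EuclideanSpace.single 1 1

/-- The derivative of `angleVec`, i.e. `angleVec` rotated by a right angle. -/
noncomputable def angleVec' (θ : ℝ) : EuclideanSpace ℝ (Fin 2) :=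
  -sin θ • EuclideanSpace.single 0 1 + cos θ • EuclideanSpace.single 1 1

lemma norm_angleVec (θ : ℝ) : ‖angleVec θ‖ = 1 := by
  simp [angleVec, EuclideanSpace.norm_eq]

lemma hasDerivAt_angleVec (θ : ℝ) : HasDerivAt angleVec (angleVec' θ) θ :=
  ((hasDerivAt_cos θ).smul_const _).add ((hasDerivAt_sin θ).smul_const _)

lemma hasDerivAt_angleVec' (θ : ℝ) : HasDerivAt angleVec' (-angleVec θ) θ := by
  have h : -angleVec θ =
      -cos θ • EuclideanSpace.single 0 1 + -sin θ • EuclideanSpace.single 1 1 := by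
    simp only [angleVec, neg_add, neg_smul]
  rw [h]
  exact ((hasDerivAt_sin θ).neg.smul_const _).add ((hasDerivAt_cos θ).smul_const _)

@[fun_prop]
lemma continuous_angleVec : Continuous angleVec := by
  unfold angleVec; fun_prop

@[fun_prop]
lemma continuous_angleVec' : Continuous angleVec' := by
  unfold angleVec'; fun_prop

/-- The Laplacian is the trace of the second derivative. -/
lemma laplacianR2_eq_trace {u : EuclideanSpace ℝ (Fin 2) → ℝ} {x : EuclideanSpace ℝ (Fin 2)}
    (hu : DifferentiableAt ℝ (fderiv ℝ u) x) (θ : ℝ) :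
    laplacianR2 u x = fderiv ℝ (fderiv ℝ u) x (angleVec θ) (angleVec θ) +
      fderiv ℝ (fderiv ℝ u) x (angleVec' θ) (angleVec' θ) := by
  have h (v w : EuclideanSpace ℝ (Fin 2)) :
      fderiv ℝ (fun y => fderiv ℝ u y v) x w = fderiv ℝ (fderiv ℝ u) x w v := by
    have := (hu.hasFDerivAt.clm_apply (hasFDerivAt_const v x)).fderiv
    rw [this]
    simp
  simp only [laplacianR2, h, Fin.sum_univ_two, angleVec, angleVec', map_add, map_smul,
    add_apply, smul_apply, smul_eq_mul]
  linear_combination (-fderiv ℝ (fderiv ℝ u) x (EuclideanSpace.single 0 1)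
    (EuclideanSpace.single 0 1) - fderiv ℝ (fderiv ℝ u) x (EuclideanSpace.single 1 1)
    (EuclideanSpace.single 1 1)) * sin_sq_add_cos_sq θ

lemma Continuous.intervalIntegral_swap {g : ℝ → ℝ → ℝ} (hg : Continuous (Function.uncurry g))
    (a b c d : ℝ) : ∫ x in a..b, ∫ y in c..d, g x y = ∫ y in c..d, ∫ x in a..b, g x y :=
  intervalIntegral_intervalIntegral_swap <|
    (hg.continuousOn.integrableOn_compact (isCompact_uIcc.prod isCompact_uIcc)).mono_set
      (prod_mono uIoc_subset_uIcc uIoc_subset_uIcc)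

lemma hasDerivAt_clm_apply_curve {V : Type*} [NormedAddCommGroup V] [NormedSpace ℝ V]
    {v : V → V →L[ℝ] ℝ} {p w : ℝ → V} {p' w' : V} {t : ℝ} (hv : DifferentiableAt ℝ v (p t))
    (hp : HasDerivAt p p' t) (hw : HasDerivAt w w' t) :
    HasDerivAt (fun t => v (p t) (w t)) (fderiv ℝ v (p t) p' (w t) + v (p t) w') t :=
  (hv.hasFDerivAt.comp_hasDerivAt t hp).clm_apply hw

lemma hasDerivAt_add_smul_const {V : Type*} [NormedAddCommGroup V] [NormedSpace ℝ V]
    (x w : V) (t : ℝ) : HasDerivAt (fun t : ℝ => x + t • w) w t := by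
  simpa using! ((hasDerivAt_id t).smul_const w).const_add x

/-- `s` times the integral of the radial derivative over the circle of radius `s` is bounded
below in terms of a lower bound of the Laplacian. -/
lemma neg_le_integral_radial_deriv {u : EuclideanSpace ℝ (Fin 2) → ℝ} (hu : ContDiff ℝ 2 u)
    {x : EuclideanSpace ℝ (Fin 2)} {b s : ℝ} (hs : 0 ≤ s)
    (hb : ∀ y ∈ ball x s, -b ≤ laplacianR2 u y) :
    -(π * b * s ^ 2) ≤ ∫ θ in -π..π, s * fderiv ℝ u (x + s • angleVec θ) (angleVec θ) := by
  have hv : ContDiff ℝ 1 (fderiv ℝ u) := hu.fderiv_right (by norm_num)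
  have hvd : Differentiable ℝ (fderiv ℝ u) := hv.differentiable (by norm_num)
  have hvc : Continuous (fderiv ℝ u) := hv.continuous
  have hBc : Continuous (fderiv ℝ (fderiv ℝ u)) := hv.continuous_fderiv (by norm_num)
  set v := fderiv ℝ u with hvdef
  set B := fderiv ℝ v with hB
  let P : ℝ → ℝ → EuclideanSpace ℝ (Fin 2) := fun σ θ => x + σ • angleVec θ
  let A : ℝ → ℝ → ℝ := fun θ σ =>
    v (P σ θ) (angleVec θ) + σ * B (P σ θ) (angleVec θ) (angleVec θ)
  let A' : ℝ → ℝ → ℝ := fun θ σ =>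
    σ * B (P σ θ) (angleVec' θ) (angleVec' θ) - v (P σ θ) (angleVec θ)
  have hA (θ : ℝ) : ∫ σ in 0..s, A θ σ = s * v (P s θ) (angleVec θ) := by
    rw [intervalIntegral.integral_eq_sub_of_hasDerivAt
      (f := fun σ => σ * v (P σ θ) (angleVec θ)) (f' := A θ)]
    · simp
    · intro σ _
      have h := (hasDerivAt_id' σ).fun_mul (hasDerivAt_clm_apply_curve (hvd (P σ θ))
        (hasDerivAt_add_smul_const x (angleVec θ) σ) (hasDerivAt_const σ (angleVec θ)))
      rwa [map_zero, add_zero, one_mul] at h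
    · exact (by fun_prop : Continuous (A θ)).intervalIntegrable _ _
  have hA' (σ : ℝ) : ∫ θ in -π..π, A' θ σ = 0 := by
    rw [intervalIntegral.integral_eq_sub_of_hasDerivAt
      (f := fun θ => v (P σ θ) (angleVec' θ)) (f' := fun θ => A' θ σ)]
    · simp [P, angleVec, angleVec']
    · intro θ _
      have hP : HasDerivAt (fun θ => P σ θ) (σ • angleVec' θ) θ :=
        ((hasDerivAt_angleVec θ).const_smul σ).const_add x
      have h := hasDerivAt_clm_apply_curve (hvd (P σ θ)) hP (hasDerivAt_angleVec' θ)
      rwa [map_smul, smul_apply, smul_eq_mul, map_neg, ← sub_eq_add_neg] at h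
    · exact (by fun_prop : Continuous (fun θ => A' θ σ)).intervalIntegrable _ _
  have hsum (θ σ : ℝ) : A θ σ + A' θ σ = σ * laplacianR2 u (P σ θ) := by
    rw [laplacianR2_eq_trace (hvd _) θ]
    simp only [A, A', ← hvdef, ← hB]
    ring
  have hcont : Continuous (fun σ => ∫ θ in -π..π, A θ σ) :=
    intervalIntegral.continuous_parametric_intervalIntegral_of_continuous'
      (f := fun σ θ => A θ σ) (by simp only [Function.uncurry_def]; fun_prop) _ _
  calc -(π * b * s ^ 2) = ∫ σ in 0..s, -(2 * π * b) * σ := by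
        rw [intervalIntegral.integral_const_mul, integral_id]; ring
    _ ≤ ∫ σ in 0..s, ∫ θ in -π..π, A θ σ := by
        apply intervalIntegral.integral_mono_on_of_le_Ioo hs
          (Continuous.intervalIntegrable (by fun_prop) _ _) (hcont.intervalIntegrable _ _)
        intro σ hσ
        have h1 : ∫ θ in -π..π, A θ σ = ∫ θ in -π..π, (A θ σ + A' θ σ) := by
          rw [intervalIntegral.integral_add (f := fun θ => A θ σ) (g := fun θ => A' θ σ)
            (Continuous.intervalIntegrable (by fun_prop) _ _)
            (Continuous.intervalIntegrable (by fun_prop) _ _), hA', add_zero]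
        have h2 : -(2 * π * b) * σ = ∫ θ in -π..π, -(b * σ) := by
          rw [intervalIntegral.integral_const, smul_eq_mul]; ring
        rw [h1, h2]
        apply intervalIntegral.integral_mono_on (by linarith [pi_pos])
          (Continuous.intervalIntegrable (by fun_prop) _ _)
          ((by fun_prop : Continuous (fun θ => A θ σ + A' θ σ)).intervalIntegrable _ _)
        intro θ _
        rw [hsum]
        have : P σ θ ∈ ball x s := by
          simpa [P, norm_smul, norm_angleVec, abs_of_pos hσ.1] using hσ.2
        nlinarith [hb _ this, hσ.1]
    _ = ∫ θ in -π..π, ∫ σ in 0..s, A θ σ :=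
        Continuous.intervalIntegral_swap (g := fun σ θ => A θ σ)
          (by simp only [Function.uncurry_def]; fun_prop) _ _ _ _
    _ = _ := by simp only [hA, P]

/-- Mean value inequality on circles. -/
lemma circle_mean_value {u : EuclideanSpace ℝ (Fin 2) → ℝ} (hu : ContDiff ℝ 2 u)
    {x : EuclideanSpace ℝ (Fin 2)} {b s : ℝ} (hs : 0 ≤ s)
    (hb : ∀ y ∈ ball x s, -b ≤ laplacianR2 u y) :
    2 * π * u x - π * b * s ^ 2 / 2 ≤ ∫ θ in -π..π, u (x + s • angleVec θ) := by
  have hvc : Continuous (fderiv ℝ u) := hu.continuous_fderiv (by norm_num)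
  have huc : Continuous u := hu.continuous
  let G : ℝ → ℝ → ℝ := fun σ θ => fderiv ℝ u (x + σ • angleVec θ) (angleVec θ)
  have hGc : Continuous (Function.uncurry G) := by
    simp only [G, Function.uncurry_def]; fun_prop
  have hG (θ : ℝ) : ∫ σ in 0..s, G σ θ = u (x + s • angleVec θ) - u x := by
    rw [intervalIntegral.integral_eq_sub_of_hasDerivAt
      (f := fun σ => u (x + σ • angleVec θ)) (f' := fun σ => G σ θ)]
    · simp
    · intro σ _
      exact (hu.differentiable (by norm_num) _).hasFDerivAt.comp_hasDerivAt σ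
        (hasDerivAt_add_smul_const x (angleVec θ) σ)
    · exact (by fun_prop : Continuous (fun σ => G σ θ)).intervalIntegrable _ _
  have hcont : Continuous (fun σ => ∫ θ in -π..π, G σ θ) :=
    intervalIntegral.continuous_parametric_intervalIntegral_of_continuous' hGc _ _
  have key : -(π * b * s ^ 2 / 2) ≤ ∫ θ in -π..π, (u (x + s • angleVec θ) - u x) :=
    calc -(π * b * s ^ 2 / 2) = ∫ σ in 0..s, -(π * b) * σ := by
          rw [intervalIntegral.integral_const_mul, integral_id]; ring
      _ ≤ ∫ σ in 0..s, ∫ θ in -π..π, G σ θ := by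
          apply intervalIntegral.integral_mono_on_of_le_Ioo hs
            (Continuous.intervalIntegrable (by fun_prop) _ _) (hcont.intervalIntegrable _ _)
          intro σ hσ
          have h := neg_le_integral_radial_deriv hu hσ.1.le
            (fun y hy => hb y (ball_subset_ball hσ.2.le hy))
          rw [intervalIntegral.integral_const_mul] at h
          refine le_of_mul_le_mul_left (?_ : σ * _ ≤ σ * _) hσ.1
          linarith
      _ = ∫ θ in -π..π, ∫ σ in 0..s, G σ θ := hGc.intervalIntegral_swap _ _ _ _
      _ = _ := by simp only [hG]
  rw [intervalIntegral.integral_sub (Continuous.intervalIntegrable (by fun_prop) _ _)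
    (by simp), intervalIntegral.integral_const, smul_eq_mul] at key
  linarith

/-- Integration over a disc in polar coordinates. -/
lemma setIntegral_ball_eq_polar {u : EuclideanSpace ℝ (Fin 2) → ℝ} (hu : Continuous u)
    (x : EuclideanSpace ℝ (Fin 2)) {ρ : ℝ} (hρ : 0 ≤ ρ) :
    ∫ y in ball x ρ, u y = ∫ s in 0..ρ, s * ∫ θ in -π..π, u (x + s • angleVec θ) := by
  let F := (ball x ρ).indicator u
  let M := MeasurableEquiv.finTwoArrow.symm.trans (MeasurableEquiv.toLp 2 (Fin 2 → ℝ))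
  have hM : MeasurePreserving M :=
    (EuclideanSpace.volume_preserving_symm_measurableEquiv_toLp (Fin 2)).symm.comp
      (volume_preserving_finTwoArrow ℝ).symm
  have hMp (p : ℝ × ℝ) : M (polarCoord.symm p) = p.1 • angleVec p.2 := by
    ext i
    fin_cases i <;> simp [M, angleVec, MeasurableEquiv.finTwoArrow]
  have hcont : Continuous fun p : ℝ × ℝ => p.1 * u (x + p.1 • angleVec p.2) := by fun_prop
  calc ∫ y in ball x ρ, u y = ∫ y, F y := (integral_indicator measurableSet_ball).symm
    _ = ∫ y, F (x + y) := (integral_add_left_eq_self F x).symm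
    _ = ∫ p, F (x + M p) := (hM.integral_comp' (fun y => F (x + y))).symm
    _ = ∫ p in polarCoord.target, p.1 • F (x + M (polarCoord.symm p)) :=
        (integral_comp_polarCoord_symm fun p => F (x + M p)).symm
    _ = ∫ p in polarCoord.target, (Iio ρ ×ˢ univ).indicator
          (fun p : ℝ × ℝ => p.1 * u (x + p.1 • angleVec p.2)) p := by
        refine setIntegral_congr_fun polarCoord.open_target.measurableSet fun p hp => ?_
        have hp0 : 0 < p.1 := hp.1
        simp only [hMp]
        by_cases h : p.1 < ρ <;> simp [F, h, norm_smul, norm_angleVec, abs_of_pos hp0]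
    _ = ∫ p in Ioo 0 ρ ×ˢ Ioo (-π) π, p.1 * u (x + p.1 • angleVec p.2) := by
        rw [setIntegral_indicator (measurableSet_Iio.prod MeasurableSet.univ)]
        congr 2
        rw [polarCoord_target, prod_inter_prod, inter_univ, Ioi_inter_Iio]
    _ = ∫ s in Ioo 0 ρ, ∫ θ in Ioo (-π) π, s * u (x + s • angleVec θ) := by
        apply setIntegral_prod
        exact (hcont.continuousOn.integrableOn_compact
          (isCompact_Icc.prod isCompact_Icc)).mono_set
          (prod_mono Ioo_subset_Icc_self Ioo_subset_Icc_self)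
    _ = _ := by
        rw [intervalIntegral.integral_of_le hρ, integral_Ioc_eq_integral_Ioo]
        refine setIntegral_congr_fun measurableSet_Ioo fun s _ => ?_
        rw [intervalIntegral.integral_of_le (by linarith [pi_pos]), integral_Ioc_eq_integral_Ioo,
          integral_const_mul]

/-- Mean value inequality on discs. -/
lemma ball_mean_value {u : EuclideanSpace ℝ (Fin 2) → ℝ} (hu : ContDiff ℝ 2 u)
    {x : EuclideanSpace ℝ (Fin 2)} {b ρ : ℝ} (hρ : 0 ≤ ρ)
    (hb : ∀ y ∈ ball x ρ, -b ≤ laplacianR2 u y) :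
    π * ρ ^ 2 * u x - π * b * ρ ^ 4 / 8 ≤ ∫ y in ball x ρ, u y := by
  have huc : Continuous u := hu.continuous
  have hcont : Continuous fun s : ℝ => ∫ θ in -π..π, u (x + s • angleVec θ) :=
    intervalIntegral.continuous_parametric_intervalIntegral_of_continuous'
      (by simp only [Function.uncurry_def]; fun_prop) _ _
  rw [setIntegral_ball_eq_polar huc x hρ]
  calc π * ρ ^ 2 * u x - π * b * ρ ^ 4 / 8
      = ∫ s in 0..ρ, (2 * π * u x * s - π * b / 2 * s ^ 3) := by
        rw [intervalIntegral.integral_sub (Continuous.intervalIntegrable (by fun_prop) _ _)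
          (Continuous.intervalIntegrable (by fun_prop) _ _),
          intervalIntegral.integral_const_mul, intervalIntegral.integral_const_mul, integral_id,
          integral_pow]
        norm_num
        ring
    _ ≤ _ := by
        apply intervalIntegral.integral_mono_on_of_le_Ioo hρ
          (Continuous.intervalIntegrable (by fun_prop) _ _)
          (Continuous.intervalIntegrable (by fun_prop) _ _)
        intro s hs
        have h := circle_mean_value hu hs.1.le
          (fun y hy => hb y (ball_subset_ball hs.2.le hy))
        nlinarith [mul_le_mul_of_nonneg_left h hs.1.le]

/-- Heinz' lemma for a function that is `C²` on the whole plane. -/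
lemma heinz_of_contDiff {r c : ℝ} (hr : 0 < r) (hc : 0 ≤ c)
    {f : EuclideanSpace ℝ (Fin 2) → ℝ} (hf : ContDiff ℝ 2 f)
    (hpos : ∀ x ∈ ball 0 r, 0 ≤ f x)
    (hlap : ∀ x ∈ ball 0 r, -(c * f x ^ 2) ≤ laplacianR2 f x)
    (hint : 8 * c * ∫ x in ball 0 r, f x < π) :
    π * r ^ 2 * f 0 ≤ 8 * ∫ x in ball 0 r, f x := by
  have hfc : Continuous f := hf.continuous
  have hfi : IntegrableOn f (ball 0 r) :=
    (hfc.continuousOn.integrableOn_compact (isCompact_closedBall 0 r)).mono_set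
      ball_subset_closedBall
  set E := ∫ x in ball 0 r, f x with hE
  have hE0 : 0 ≤ E := setIntegral_nonneg measurableSet_ball hpos
  obtain ⟨z, hz, hmax⟩ := (isCompact_closedBall (0 : EuclideanSpace ℝ (Fin 2)) r).exists_isMaxOn
    ⟨0, by simp [hr.le]⟩ (f := fun z => (r - ‖z‖) ^ 2 * f z) (by fun_prop)
  have hmax0 : r ^ 2 * f 0 ≤ (r - ‖z‖) ^ 2 * f z := by
    simpa using hmax (by simp [hr.le] : (0 : EuclideanSpace ℝ (Fin 2)) ∈ closedBall 0 r)
  rw [mem_closedBall_zero_iff] at hz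
  rcases hz.eq_or_lt with hz | hz
  · rw [hz] at hmax0
    nlinarith [pi_pos]
  obtain ⟨ε, hε⟩ : ∃ ε, ε = (r - ‖z‖) / 2 := ⟨_, rfl⟩
  have hε0 : 0 < ε := by linarith
  have hsub : ball z ε ⊆ ball 0 r := by
    apply ball_subset_ball'
    rw [dist_zero_right]
    linarith
  have hfz : 0 ≤ f z := hpos z (by simpa using hz)
  have hbound (y) (hy : y ∈ ball z ε) : f y ≤ 4 * f z := by
    have hyr := hsub hy
    have h1 : (r - ‖y‖) ^ 2 * f y ≤ (r - ‖z‖) ^ 2 * f z := hmax (ball_subset_closedBall hyr)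
    have h2 : ε ≤ r - ‖y‖ := by
      have := norm_le_norm_add_norm_sub' y z
      rw [mem_ball, dist_eq_norm] at hy
      linarith
    have h3 : ε ^ 2 * f y ≤ (r - ‖y‖) ^ 2 * f y := by
      gcongr
      exact hpos y hyr
    rw [show r - ‖z‖ = 2 * ε by linarith] at h1
    refine le_of_mul_le_mul_left (?_ : ε ^ 2 * _ ≤ ε ^ 2 * _) (by positivity)
    linarith
  have hmean (ρ : ℝ) (hρ : 0 ≤ ρ) (hρε : ρ ≤ ε) :
      π * ρ ^ 2 * f z - π * (16 * c * f z ^ 2) * ρ ^ 4 / 8 ≤ E := by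
    refine (ball_mean_value hf hρ fun y hy => ?_).trans
      (setIntegral_mono_set hfi ?_ ((ball_subset_ball hρε).trans hsub).eventuallyLE)
    · have hyε := ball_subset_ball hρε hy
      refine le_trans ?_ (hlap y (hsub hyε))
      have : f y ^ 2 ≤ (4 * f z) ^ 2 := pow_le_pow_left₀ (hpos y (hsub hyε)) (hbound y hyε) 2
      nlinarith
    · exact (ae_restrict_iff' measurableSet_ball).2 (ae_of_all _ hpos)
  rw [show r - ‖z‖ = 2 * ε by linarith] at hmax0
  rcases le_or_gt (4 * c * f z * ε ^ 2) 1 with h | h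
  · have h1 := hmean ε hε0.le le_rfl
    have h2 : 0 ≤ π * ε ^ 2 * f z / 2 * (1 - 4 * c * f z * ε ^ 2) :=
      mul_nonneg (by positivity) (by linarith)
    nlinarith [pi_pos]
  · have hpos' : 0 < 4 * c * f z := by
      by_contra! hle
      nlinarith [sq_nonneg ε]
    have hsq : √(1 / (4 * c * f z)) ^ 2 = 1 / (4 * c * f z) := sq_sqrt (by positivity)
    have h1 := hmean √(1 / (4 * c * f z)) (sqrt_nonneg _) (by
      rw [sqrt_le_left hε0.le, div_le_iff₀ hpos']
      linarith)
    rw [show √(1 / (4 * c * f z)) ^ 4 = (√(1 / (4 * c * f z)) ^ 2) ^ 2 by ring, hsq] at h1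
    have hc0 : c ≠ 0 := by rintro rfl; simp at hpos'
    have hz0 : f z ≠ 0 := by intro h0; simp [h0] at hpos'
    have h2 : π * (1 / (4 * c * f z)) * f z - π * (16 * c * f z ^ 2) * (1 / (4 * c * f z)) ^ 2 / 8
        = π / (8 * c) := by
      field_simp
      ring
    rw [h2, div_le_iff₀ (by positivity)] at h1
    linarith

/-- A `C²` function on an open ball agrees with a globally `C²` function on a smaller ball. -/
lemma ContDiffOn.exists_contDiff_eqOn_ball {V : Type*} [NormedAddCommGroup V]
    [InnerProductSpace ℝ V] {n : ℕ} {f : V → ℝ} {x : V} {r ρ : ℝ}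
    (hf : ContDiffOn ℝ n f (ball x r)) (hρ : 0 < ρ) (hρr : ρ < r) :
    ∃ g : V → ℝ, ContDiff ℝ n g ∧ EqOn g f (ball x ρ) := by
  let φ : ContDiffBump x := ⟨ρ, (ρ + r) / 2, hρ, by linarith⟩
  have hφ : tsupport (φ : V → ℝ) ⊆ ball x r :=
    closure_minimal (φ.support_eq.subset.trans ball_subset_closedBall) isClosed_closedBall |>.trans
      (closedBall_subset_ball (by simp only [φ]; linarith))
  refine ⟨fun y => φ y * f y, ?_, fun y hy => ?_⟩
  · rw [contDiff_iff_contDiffAt]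
    intro y
    by_cases hy : y ∈ ball x r
    · exact φ.contDiff.contDiffAt.mul (hf.contDiffAt (isOpen_ball.mem_nhds hy))
    · have h0 := notMem_tsupport_iff_eventuallyEq.1 fun h => hy (hφ h)
      refine (contDiffAt_const (c := (0 : ℝ))).congr_of_eventuallyEq ?_
      filter_upwards [h0] with w hw
      simp [hw]
  · simp [φ.one_of_mem_closedBall (ball_subset_closedBall hy)]

lemma laplacianR2_congr {f g : EuclideanSpace ℝ (Fin 2) → ℝ} {x : EuclideanSpace ℝ (Fin 2)}
    (h : f =ᶠ[𝓝 x] g) : laplacianR2 f x = laplacianR2 g x := by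
  refine Finset.sum_congr rfl fun i _ => ?_
  have hfg : (fun y => fderiv ℝ f y (EuclideanSpace.single i (1 : ℝ))) =ᶠ[𝓝 x]
      fun y => fderiv ℝ g y (EuclideanSpace.single i (1 : ℝ)) := by
    filter_upwards [h.fderiv (𝕜 := ℝ)] with y hy
    rw [hy]
  rw [hfg.fderiv_eq]

/-- **Heinz' lemma.** Let `r > 0` and `c ≥ 0`. Every `C²` function `f : B_r → ℝ` on the open
ball `B_r ⊆ ℝ²` satisfying `f ≥ 0`, `Δf ≥ -c f²` pointwise on `B_r`, and
`8c ∫_{B_r} f < π`, also satisfies `f(0) ≤ (8 / (π r²)) ∫_{B_r} f`. -/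
theorem heinz_lemma (r c : ℝ) (hr : 0 < r) (hc : 0 ≤ c)
    (f : EuclideanSpace ℝ (Fin 2) → ℝ)
    (hf : ContDiffOn ℝ 2 f (Metric.ball 0 r))
    (hpos : ∀ x ∈ Metric.ball (0 : EuclideanSpace ℝ (Fin 2)) r, 0 ≤ f x)
    (hlap : ∀ x ∈ Metric.ball (0 : EuclideanSpace ℝ (Fin 2)) r,
      -(c * f x ^ 2) ≤ laplacianR2 f x)
    (hint : ENNReal.ofReal (8 * c) *
        (∫⁻ x in Metric.ball (0 : EuclideanSpace ℝ (Fin 2)) r, ENNReal.ofReal (f x))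
      < ENNReal.ofReal Real.pi) :
    ENNReal.ofReal (f 0) ≤ ENNReal.ofReal (8 / (Real.pi * r ^ 2)) *
      ∫⁻ x in Metric.ball (0 : EuclideanSpace ℝ (Fin 2)) r, ENNReal.ofReal (f x) := by
  rcases eq_or_ne (∫⁻ x in ball 0 r, ENNReal.ofReal (f x)) ⊤ with hE | hE
  · rw [hE, ENNReal.mul_top (ENNReal.ofReal_pos.2 (by positivity)).ne']
    exact le_top
  have hfi : IntegrableOn f (ball 0 r) :=
    (lintegral_ofReal_ne_top_iff_integrable
      (hf.continuousOn.aestronglyMeasurable measurableSet_ball)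
      ((ae_restrict_iff' measurableSet_ball).2 (ae_of_all _ hpos))).1 hE
  have hEq := ofReal_integral_eq_lintegral_ofReal hfi
    ((ae_restrict_iff' measurableSet_ball).2 (ae_of_all _ hpos))
  rw [← hEq, ← ENNReal.ofReal_mul (by positivity)] at hint ⊢
  rw [ENNReal.ofReal_lt_ofReal_iff pi_pos] at hint
  apply ENNReal.ofReal_le_ofReal
  have hsmall (ρ : ℝ) (hρ : 0 < ρ) (hρr : ρ < r) :
      π * ρ ^ 2 * f 0 ≤ 8 * ∫ x in ball 0 r, f x := by
    obtain ⟨g, hg, hgf⟩ := hf.exists_contDiff_eqOn_ball (n := 2) hρ hρr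
    have hsub : ball (0 : EuclideanSpace ℝ (Fin 2)) ρ ⊆ ball 0 r := ball_subset_ball hρr.le
    have hgi : ∫ x in ball 0 ρ, g x ≤ ∫ x in ball 0 r, f x := by
      rw [setIntegral_congr_fun measurableSet_ball hgf]
      exact setIntegral_mono_set hfi
        ((ae_restrict_iff' measurableSet_ball).2 (ae_of_all _ hpos)) hsub.eventuallyLE
    have h := heinz_of_contDiff hρ hc hg (fun x hx => hgf hx ▸ hpos x (hsub hx))
      (fun x hx => by
        rw [laplacianR2_congr (hgf.eventuallyEq_of_mem (isOpen_ball.mem_nhds hx)), hgf hx]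
        exact hlap x (hsub hx))
      (lt_of_le_of_lt (by gcongr) hint)
    rw [hgf (mem_ball_self hρ)] at h
    linarith
  have hlim : π * r ^ 2 * f 0 ≤ 8 * ∫ x in ball 0 r, f x := by
    refine le_of_tendsto (f := fun ρ : ℝ => π * ρ ^ 2 * f 0) (x := 𝓝[<] r)
      ((by fun_prop : Continuous fun ρ : ℝ => π * ρ ^ 2 * f 0).tendsto r |>.mono_left
        nhdsWithin_le_nhds) ?_
    filter_upwards [Ioo_mem_nhdsLT hr] with ρ hρ using hsmall ρ hρ.1 hρ.2
  rw [div_mul_eq_mul_div, le_div_iff₀ (by positivity)]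
  linarith
end

section
/- Let n ∈ ℕ, n < p < ∞, and λ ∈ ℝ. Then there exists a constant C > 0 such that every continuously differentiable function u : ℝⁿ → ℝ satisfies sup_{x∈ℝⁿ} ⟨x⟩^{λ + n/p} |u(x)| ≤ C (‖⟨·⟩^λ u‖_{L^p(ℝⁿ)} + ‖⟨·⟩^{λ+1} ‖Du‖‖_{L^p(ℝⁿ)}), where both sides are allowed to be infinite. -/
open MeasureTheory
open scoped ENNReal

/-- The Japanese bracket `⟨x⟩ = √(1 + |x|²)`. -/
noncomputable def jbracket {n : ℕ} (x : EuclideanSpace ℝ (Fin n)) : ℝ :=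
  Real.sqrt (1 + ‖x‖ ^ 2)

theorem one_le_jbracket {n : ℕ} (x : EuclideanSpace ℝ (Fin n)) : 1 ≤ jbracket x :=
  Real.one_le_sqrt.2 (by nlinarith [sq_nonneg ‖x‖])

theorem jbracket_pos {n : ℕ} (x : EuclideanSpace ℝ (Fin n)) : 0 < jbracket x :=
  one_pos.trans_le (one_le_jbracket x)

theorem continuous_jbracket {n : ℕ} :
    Continuous (jbracket : EuclideanSpace ℝ (Fin n) → ℝ) := by
  unfold jbracket
  fun_prop

theorem continuous_jbracket_rpow {n : ℕ} (s : ℝ) :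
    Continuous fun x : EuclideanSpace ℝ (Fin n) => jbracket x ^ s :=
  continuous_jbracket.rpow_const fun x => Or.inl (jbracket_pos x).ne'

theorem jbracket_add_le {n : ℕ} (x y : EuclideanSpace ℝ (Fin n)) :
    jbracket (x + y) ≤ jbracket x + ‖y‖ := by
  have hx : jbracket x ^ 2 = 1 + ‖x‖ ^ 2 := Real.sq_sqrt (by positivity)
  have hle : ‖x‖ ≤ jbracket x := Real.le_sqrt_of_sq_le (by linarith)
  have hxy := norm_add_le x y
  refine Real.sqrt_le_iff.2 ⟨by linarith [norm_nonneg x, norm_nonneg y], ?_⟩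
  nlinarith [norm_nonneg x, norm_nonneg y, norm_nonneg (x + y),
    mul_le_mul_of_nonneg_right hle (norm_nonneg y)]

/-- Powers of comparable positive numbers are comparable. -/
theorem rpow_le_two_rpow_abs_mul {a b : ℝ} (ha : 0 < a) (hb : 0 < b) (hab : a ≤ 2 * b)
    (hba : b ≤ 2 * a) (s : ℝ) : a ^ s ≤ 2 ^ |s| * b ^ s := by
  have hlog : |Real.log a - Real.log b| ≤ Real.log 2 := by
    have h1 := Real.log_le_log ha hab
    have h2 := Real.log_le_log hb hba
    rw [Real.log_mul two_ne_zero hb.ne'] at h1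
    rw [Real.log_mul two_ne_zero ha.ne'] at h2
    exact abs_le.2 ⟨by linarith, by linarith⟩
  rw [Real.rpow_def_of_pos ha, Real.rpow_def_of_pos hb, Real.rpow_def_of_pos two_pos,
    ← Real.exp_add, Real.exp_le_exp]
  have h := le_abs_self ((Real.log a - Real.log b) * s)
  rw [abs_mul] at h
  nlinarith [mul_le_mul_of_nonneg_right hlog (abs_nonneg s)]

/-- On the ball of radius `⟨x⟩ / 2` about `x`, the weight `⟨·⟩ ^ s` is comparable to `⟨x⟩ ^ s`. -/
theorem jbracket_rpow_le {n : ℕ} (s : ℝ) {x y : EuclideanSpace ℝ (Fin n)}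
    (hy : ‖y‖ ≤ jbracket x / 2) : jbracket x ^ s ≤ 2 ^ |s| * jbracket (x + y) ^ s := by
  have h1 := jbracket_add_le x y
  have h2 := jbracket_add_le (x + y) (-y)
  rw [add_neg_cancel_right, norm_neg] at h2
  exact rpow_le_two_rpow_abs_mul (jbracket_pos x) (jbracket_pos _) (by linarith)
    (by linarith [jbracket_pos x]) s

/-- Hölder's inequality on the ball of radius `s` about `x`, rescaled to the unit ball. -/
theorem setLIntegral_ball_enorm_comp_le {n : ℕ} {p : ℝ} (hp : 1 ≤ p)
    {h : EuclideanSpace ℝ (Fin n) → ℝ} (hh : Continuous h) (x : EuclideanSpace ℝ (Fin n))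
    {s : ℝ} (hs : 0 < s) :
    ∫⁻ z in Metric.ball 0 1, ‖h (x + s • z)‖ₑ ≤
      volume (Metric.ball (0 : EuclideanSpace ℝ (Fin n)) 1) ^ (1 - 1 / p) *
        ENNReal.ofReal (s ^ (-(n / p))) * eLpNorm h (ENNReal.ofReal p) volume := by
  have hp0 : 0 < p := one_pos.trans_le hp
  have hφ : Continuous fun z : EuclideanSpace ℝ (Fin n) => x + s • z := by fun_prop
  have hmap : Measure.map (fun z : EuclideanSpace ℝ (Fin n) => x + s • z) volume =
      ENNReal.ofReal ((s ^ n)⁻¹) • volume := by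
    have hcomp : (fun z : EuclideanSpace ℝ (Fin n) => x + s • z) = (x + ·) ∘ (s • ·) := rfl
    rw [hcomp, ← Measure.map_map (by fun_prop) (by fun_prop), Measure.map_addHaar_smul _ hs.ne',
      Measure.map_smul, map_add_left_eq_self, finrank_euclideanSpace_fin,
      abs_of_pos (by positivity)]
  have hscale : eLpNorm (fun z => h (x + s • z)) (ENNReal.ofReal p) volume =
      ENNReal.ofReal (s ^ (-(n / p))) * eLpNorm h (ENNReal.ofReal p) volume := by
    have := eLpNorm_map_measure (p := ENNReal.ofReal p) (μ := volume) (g := h)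
      (f := fun z => x + s • z) (hh.aestronglyMeasurable) hφ.aemeasurable
    rw [Function.comp_def] at this
    rw [← this, hmap, eLpNorm_smul_measure_of_ne_top ENNReal.ofReal_ne_top, smul_eq_mul,
      ENNReal.toReal_div, ENNReal.toReal_ofReal hp0.le, ENNReal.toReal_one,
      ENNReal.ofReal_rpow_of_pos (by positivity)]
    congr 2
    rw [← Real.rpow_natCast, ← Real.rpow_neg hs.le, ← Real.rpow_mul hs.le]
    congr 1
    ring
  calc ∫⁻ z in Metric.ball 0 1, ‖h (x + s • z)‖ₑ
      = eLpNorm (fun z => h (x + s • z)) 1 (volume.restrict (Metric.ball 0 1)) :=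
        eLpNorm_one_eq_lintegral_enorm.symm
    _ ≤ eLpNorm (fun z => h (x + s • z)) (ENNReal.ofReal p) (volume.restrict (Metric.ball 0 1)) *
          volume (Metric.ball (0 : EuclideanSpace ℝ (Fin n)) 1) ^ (1 - 1 / p) := by
        have := eLpNorm_le_eLpNorm_mul_rpow_measure_univ (p := 1) (q := ENNReal.ofReal p)
          (μ := volume.restrict (Metric.ball (0 : EuclideanSpace ℝ (Fin n)) 1))
          (f := fun z => h (x + s • z)) (by simpa using hp)
          (hh.comp hφ).aestronglyMeasurable
        simpa [ENNReal.toReal_ofReal hp0.le] using this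
    _ ≤ eLpNorm (fun z => h (x + s • z)) (ENNReal.ofReal p) volume *
          volume (Metric.ball (0 : EuclideanSpace ℝ (Fin n)) 1) ^ (1 - 1 / p) := by
        gcongr
        exact Measure.restrict_le_self
    _ = _ := by rw [hscale]; ring

/-- The fundamental theorem of calculus along a segment, as an inequality. -/
theorem enorm_le_add_lintegral_fderiv {E : Type*} [NormedAddCommGroup E] [NormedSpace ℝ E]
    {u : E → ℝ} (hu : ContDiff ℝ 1 u) (x v : E) :
    ‖u x‖ₑ ≤ ‖u (x + v)‖ₑ + ∫⁻ t in Set.Ioc (0 : ℝ) 1, ‖v‖ₑ * ‖fderiv ℝ u (x + t • v)‖ₑ := by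
  have hderiv (t : ℝ) : HasDerivAt (fun t : ℝ => u (x + t • v)) (fderiv ℝ u (x + t • v) v) t := by
    have h1 : HasDerivAt (fun t : ℝ => x + t • v) v t := by
      simpa using ((hasDerivAt_id t).smul_const v).const_add x
    exact ((hu.differentiable one_ne_zero).differentiableAt.hasFDerivAt).comp_hasDerivAt t h1
  have hcont : Continuous fun t : ℝ => fderiv ℝ u (x + t • v) v :=
    ((hu.continuous_fderiv one_ne_zero).comp (by fun_prop)).clm_apply continuous_const
  have hftc := intervalIntegral.integral_eq_sub_of_hasDerivAt (a := 0) (b := 1)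
    (fun t _ => hderiv t) (hcont.intervalIntegrable _ _)
  rw [zero_smul, one_smul, add_zero, intervalIntegral.integral_of_le zero_le_one] at hftc
  have hsub : u x = u (x + v) - ∫ t in Set.Ioc (0 : ℝ) 1, fderiv ℝ u (x + t • v) v := by
    rw [hftc]; ring
  rw [hsub]
  refine (enorm_sub_le).trans ?_
  gcongr
  refine (enorm_integral_le_lintegral_enorm _).trans (lintegral_mono fun t => ?_)
  rw [mul_comm]
  exact (fderiv ℝ u (x + t • v)).le_opENorm v

theorem lintegral_Ioc_zero_one_rpow_ne_top {d : ℝ} (hd : d < 1) :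
    ∫⁻ t in Set.Ioc (0 : ℝ) 1, ENNReal.ofReal (t ^ (-d)) ≠ ⊤ := by
  have h := (intervalIntegral.intervalIntegrable_rpow' (a := 0) (b := 1) (r := -d)
    (by linarith)).1
  exact h.lintegral_lt_top.ne

/-- The weighted Morrey inequality at a point, with an explicit constant. -/
theorem volume_ball_mul_weighted_enorm_le {n : ℕ} {p lam : ℝ} (hp : 1 ≤ p)
    {u : EuclideanSpace ℝ (Fin n) → ℝ} (hu : ContDiff ℝ 1 u) (x : EuclideanSpace ℝ (Fin n)) :
    volume (Metric.ball (0 : EuclideanSpace ℝ (Fin n)) 1) *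
        (ENNReal.ofReal (jbracket x ^ lam) * ‖u x‖ₑ) ≤
      volume (Metric.ball (0 : EuclideanSpace ℝ (Fin n)) 1) ^ (1 - 1 / p) *
        ENNReal.ofReal ((jbracket x / 2) ^ (-(n / p))) *
        (ENNReal.ofReal (2 ^ |lam|) *
            eLpNorm (fun x => jbracket x ^ lam * u x) (ENNReal.ofReal p) volume +
          ENNReal.ofReal (2 ^ |lam + 1|) *
            (∫⁻ t in Set.Ioc (0 : ℝ) 1, ENNReal.ofReal (t ^ (-(n / p)))) *
            eLpNorm (fun x => jbracket x ^ (lam + 1) * ‖fderiv ℝ u x‖)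
              (ENNReal.ofReal p) volume) := by
  set B := Metric.ball (0 : EuclideanSpace ℝ (Fin n)) 1
  set r := jbracket x / 2
  set f := fun x => jbracket x ^ lam * u x with hf_def
  set g := fun x => jbracket x ^ (lam + 1) * ‖fderiv ℝ u x‖ with hg_def
  have ha : 0 < jbracket x := jbracket_pos x
  have hr : 0 < r := half_pos ha
  have hf : Continuous f := (continuous_jbracket_rpow lam).mul hu.continuous
  have hg : Continuous g :=
    (continuous_jbracket_rpow (lam + 1)).mul (hu.continuous_fderiv one_ne_zero).norm
  have hfu {y : EuclideanSpace ℝ (Fin n)} (hy : ‖y‖ ≤ r) :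
      ENNReal.ofReal (jbracket x ^ lam) * ‖u (x + y)‖ₑ ≤
        ENNReal.ofReal (2 ^ |lam|) * ‖f (x + y)‖ₑ := by
    rw [hf_def, enorm_mul, Real.enorm_of_nonneg (Real.rpow_nonneg (jbracket_pos _).le _),
      ← mul_assoc, ← ENNReal.ofReal_mul (by positivity)]
    gcongr
    exact jbracket_rpow_le lam hy
  have hgu {y : EuclideanSpace ℝ (Fin n)} (hy : ‖y‖ ≤ r) :
      ENNReal.ofReal (jbracket x ^ lam * r) * ‖fderiv ℝ u (x + y)‖ₑ ≤
        ENNReal.ofReal (2 ^ |lam + 1|) * ‖g (x + y)‖ₑ := by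
    rw [hg_def, enorm_mul, Real.enorm_of_nonneg (Real.rpow_nonneg (jbracket_pos _).le _),
      enorm_norm, ← mul_assoc, ← ENNReal.ofReal_mul (by positivity)]
    refine mul_le_mul_left (ENNReal.ofReal_le_ofReal ?_) _
    refine le_trans ?_ (jbracket_rpow_le (lam + 1) hy)
    rw [Real.rpow_add_one ha.ne']
    gcongr
    exact half_le_self ha.le
  have hpoint {z : EuclideanSpace ℝ (Fin n)} (hz : z ∈ B) :
      ENNReal.ofReal (jbracket x ^ lam) * ‖u x‖ₑ ≤
        ENNReal.ofReal (2 ^ |lam|) * ‖f (x + r • z)‖ₑ +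
          ∫⁻ t in Set.Ioc (0 : ℝ) 1,
            ENNReal.ofReal (2 ^ |lam + 1|) * ‖g (x + (t * r) • z)‖ₑ := by
    have hz1 : ‖z‖ ≤ 1 := (mem_ball_zero_iff.1 hz).le
    have hrz : ‖r • z‖ ≤ r := by
      rw [norm_smul, Real.norm_of_nonneg hr.le]
      exact mul_le_of_le_one_right hr.le hz1
    refine (mul_le_mul_right (enorm_le_add_lintegral_fderiv hu x (r • z)) _).trans ?_
    rw [mul_add, ← lintegral_const_mul' _ _ ENNReal.ofReal_ne_top]
    refine add_le_add (hfu hrz) (setLIntegral_mono' measurableSet_Ioc fun t ht => ?_)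
    have htrz : ‖(t * r) • z‖ ≤ r := by
      rw [mul_smul, norm_smul, Real.norm_of_nonneg ht.1.le]
      exact (mul_le_of_le_one_left (norm_nonneg _) ht.2).trans hrz
    refine le_trans ?_ (hgu htrz)
    rw [smul_smul, ← mul_assoc, ENNReal.ofReal_mul (by positivity)]
    gcongr
    rw [← ofReal_norm]
    exact ENNReal.ofReal_le_ofReal hrz
  have hgmeas : Measurable fun q : EuclideanSpace ℝ (Fin n) × ℝ =>
      ENNReal.ofReal (2 ^ |lam + 1|) * ‖g (x + (q.2 * r) • q.1)‖ₑ :=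
    ((hg.comp (by fun_prop)).measurable.enorm).const_mul _
  have hfmeas : Measurable fun z => ENNReal.ofReal (2 ^ |lam|) * ‖f (x + r • z)‖ₑ :=
    ((hf.comp (by fun_prop)).measurable.enorm).const_mul _
  have hrmeas : Measurable fun t : ℝ => ENNReal.ofReal (t ^ (-(n / p))) := by fun_prop
  calc volume B * (ENNReal.ofReal (jbracket x ^ lam) * ‖u x‖ₑ)
      = ∫⁻ _ in B, ENNReal.ofReal (jbracket x ^ lam) * ‖u x‖ₑ := by
        rw [setLIntegral_const, mul_comm]
    _ ≤ ∫⁻ z in B, (ENNReal.ofReal (2 ^ |lam|) * ‖f (x + r • z)‖ₑ +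
          ∫⁻ t in Set.Ioc (0 : ℝ) 1,
            ENNReal.ofReal (2 ^ |lam + 1|) * ‖g (x + (t * r) • z)‖ₑ) :=
        setLIntegral_mono' measurableSet_ball fun z hz => hpoint hz
    _ = ENNReal.ofReal (2 ^ |lam|) * (∫⁻ z in B, ‖f (x + r • z)‖ₑ) +
          ∫⁻ t in Set.Ioc (0 : ℝ) 1,
            ENNReal.ofReal (2 ^ |lam + 1|) * ∫⁻ z in B, ‖g (x + (t * r) • z)‖ₑ := by
        rw [lintegral_add_left hfmeas, lintegral_const_mul' _ _ ENNReal.ofReal_ne_top,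
          lintegral_lintegral_swap hgmeas.aemeasurable]
        simp_rw [lintegral_const_mul' _ _ ENNReal.ofReal_ne_top]
    _ ≤ ENNReal.ofReal (2 ^ |lam|) * (volume B ^ (1 - 1 / p) *
            ENNReal.ofReal (r ^ (-(n / p))) * eLpNorm f (ENNReal.ofReal p) volume) +
          ∫⁻ t in Set.Ioc (0 : ℝ) 1, ENNReal.ofReal (t ^ (-(n / p))) *
            (ENNReal.ofReal (2 ^ |lam + 1|) * (volume B ^ (1 - 1 / p) *
              ENNReal.ofReal (r ^ (-(n / p))) * eLpNorm g (ENNReal.ofReal p) volume)) := by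
        refine add_le_add (mul_le_mul_right (setLIntegral_ball_enorm_comp_le hp hf x hr) _)
          (setLIntegral_mono' measurableSet_Ioc fun t ht => ?_)
        refine (mul_le_mul_right
          (setLIntegral_ball_enorm_comp_le hp hg x (mul_pos ht.1 hr)) _).trans_eq ?_
        rw [Real.mul_rpow ht.1.le hr.le, ENNReal.ofReal_mul (Real.rpow_nonneg ht.1.le _)]
        ring
    _ = _ := by
        rw [lintegral_mul_const _ hrmeas]
        ring

/-- **Weighted Morrey inequality.** Let `n ∈ ℕ`, `n < p < ∞`, and `λ ∈ ℝ`. Then there exists a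
constant `C > 0` such that every continuously differentiable `u : ℝⁿ → ℝ` satisfies
`sup_x ⟨x⟩^{λ + n/p} |u(x)| ≤ C (‖⟨·⟩^λ u‖_{L^p} + ‖⟨·⟩^{λ+1} ‖Du‖‖_{L^p})`,
where both sides are allowed to be infinite. -/
theorem weighted_morrey (n : ℕ) (hn : 0 < n) (p lam : ℝ) (hp : (n : ℝ) < p) :
    ∃ C : ℝ, 0 < C ∧ ∀ u : EuclideanSpace ℝ (Fin n) → ℝ, ContDiff ℝ 1 u →
      (⨆ x : EuclideanSpace ℝ (Fin n),
        ENNReal.ofReal (jbracket x ^ (lam + n / p) * |u x|)) ≤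
      ENNReal.ofReal C *
        (eLpNorm (fun x => jbracket x ^ lam * u x) (ENNReal.ofReal p) volume
          + eLpNorm (fun x => jbracket x ^ (lam + 1) * ‖fderiv ℝ u x‖)
              (ENNReal.ofReal p) volume) := by
  have hn1 : (1 : ℝ) ≤ n := by exact_mod_cast hn
  have hp1 : 1 ≤ p := hn1.trans hp.le
  have hd : (n : ℝ) / p < 1 := (div_lt_one (by linarith)).2 hp
  set V := volume (Metric.ball (0 : EuclideanSpace ℝ (Fin n)) 1)
  have hV0 : V ≠ 0 := (Metric.measure_ball_pos volume 0 one_pos).ne'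
  have hV : V ≠ ⊤ := measure_ball_lt_top.ne
  set J := ∫⁻ t in Set.Ioc (0 : ℝ) 1, ENNReal.ofReal (t ^ (-(n / p)))
  have hJ : J ≠ ⊤ := lintegral_Ioc_zero_one_rpow_ne_top hd
  set K₀ := ENNReal.ofReal (2 ^ |lam|)
  set K₁ := ENNReal.ofReal (2 ^ |lam + 1|) * J
  set M := V⁻¹ * (V ^ (1 - 1 / p) * ENNReal.ofReal (2 ^ ((n : ℝ) / p)))
  have hD : M * (K₀ + K₁) ≠ ⊤ := by
    refine ENNReal.mul_ne_top (ENNReal.mul_ne_top (ENNReal.inv_ne_top.2 hV0)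
      (ENNReal.mul_ne_top ?_ ENNReal.ofReal_ne_top))
      (ENNReal.add_ne_top.2 ⟨ENNReal.ofReal_ne_top, ENNReal.mul_ne_top ENNReal.ofReal_ne_top hJ⟩)
    exact ENNReal.rpow_ne_top_of_ne_zero hV0 hV
  refine ⟨(M * (K₀ + K₁)).toReal + 1, by positivity, fun u hu => iSup_le fun x => ?_⟩
  set F := eLpNorm (fun x => jbracket x ^ lam * u x) (ENNReal.ofReal p) volume
  set G := eLpNorm (fun x => jbracket x ^ (lam + 1) * ‖fderiv ℝ u x‖) (ENNReal.ofReal p) volume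
  have ha : 0 < jbracket x := jbracket_pos x
  have hscale : ENNReal.ofReal (jbracket x ^ ((n : ℝ) / p)) *
      ENNReal.ofReal ((jbracket x / 2) ^ (-(n / p))) = ENNReal.ofReal (2 ^ ((n : ℝ) / p)) := by
    rw [← ENNReal.ofReal_mul (by positivity), Real.div_rpow ha.le zero_le_two,
      Real.rpow_neg ha.le, Real.rpow_neg zero_le_two]
    congr 1
    field_simp
  calc ENNReal.ofReal (jbracket x ^ (lam + n / p) * |u x|)
      = V⁻¹ * (ENNReal.ofReal (jbracket x ^ ((n : ℝ) / p)) *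
          (V * (ENNReal.ofReal (jbracket x ^ lam) * ‖u x‖ₑ))) := by
        rw [Real.rpow_add ha, ENNReal.ofReal_mul (by positivity),
          ENNReal.ofReal_mul (by positivity), ← Real.enorm_eq_ofReal_abs, mul_left_comm _ V,
          ← mul_assoc V⁻¹, ENNReal.inv_mul_cancel hV0 hV, one_mul]
        ring
    _ ≤ V⁻¹ * (ENNReal.ofReal (jbracket x ^ ((n : ℝ) / p)) *
          (V ^ (1 - 1 / p) * ENNReal.ofReal ((jbracket x / 2) ^ (-(n / p))) *
            (K₀ * F + K₁ * G))) := by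
        exact mul_le_mul_right (mul_le_mul_right
          (volume_ball_mul_weighted_enorm_le hp1 hu x) _) _
    _ = M * (K₀ * F + K₁ * G) := by
        simp only [M]
        rw [← hscale]
        ring
    _ ≤ M * ((K₀ + K₁) * F + (K₀ + K₁) * G) := by
        gcongr
        · exact le_self_add
        · exact le_add_self
    _ = M * (K₀ + K₁) * (F + G) := by ring
    _ ≤ ENNReal.ofReal ((M * (K₀ + K₁)).toReal + 1) * (F + G) := by
        gcongr
        rw [← ENNReal.ofReal_toReal hD]
        exact ENNReal.ofReal_le_ofReal (by rw [ENNReal.ofReal_toReal hD]; linarith)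
end

section
/- Let (φ,ψ,f) be a vortex over ℂ in the Ginzburg–Landau setting whose energy E is finite and positive. Then |f(z)| < 1 for every z ∈ ℂ, i.e., the image of f is contained in the open unit ball B₁ ⊆ ℂ. -/
open MeasureTheory
open scoped ENNReal

/-- The energy density of a triple `(φ, ψ, f)` in the Ginzburg–Landau setting:
`e = ½(|∂ₛf + iφf|² + |∂ₜf + iψf|²) + ½(∂ₛψ - ∂ₜφ)² + ½((1 - |f|²)/2)²`. -/
noncomputable def glEnergyDensity (φ ψ : ℂ → ℝ) (f : ℂ → ℂ) (z : ℂ) : ℝ :=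
  (1/2) * (‖fderiv ℝ f z 1 + Complex.I * (φ z : ℂ) * f z‖ ^ 2
    + ‖fderiv ℝ f z Complex.I + Complex.I * (ψ z : ℂ) * f z‖ ^ 2)
  + (1/2) * (fderiv ℝ ψ z 1 - fderiv ℝ φ z Complex.I) ^ 2
  + (1/2) * ((1 - ‖f z‖ ^ 2) / 2) ^ 2

open Filter Topology

/-- `c` is the second derivative at `z` of `g` along the real line through `z` in direction `v`. -/
def HasLineSecondDeriv (g : ℂ → ℝ) (v z : ℂ) (c : ℝ) : Prop :=
  ∃ g' : ℝ → ℝ, (∀ᶠ t in 𝓝 (0 : ℝ), HasDerivAt (fun t : ℝ => g (z + t * v)) (g' t) t) ∧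
    HasDerivAt g' c 0

/-- `L` is the Laplacian of `g` at `z`, computed from second derivatives along coordinate lines. -/
def HasLaplacianAt (g : ℂ → ℝ) (z : ℂ) (L : ℝ) : Prop :=
  ∃ c d : ℝ, HasLineSecondDeriv g 1 z c ∧ HasLineSecondDeriv g Complex.I z d ∧ c + d = L

theorem HasLineSecondDeriv.sub {g h : ℂ → ℝ} {v z : ℂ} {c d : ℝ}
    (hg : HasLineSecondDeriv g v z c) (hh : HasLineSecondDeriv h v z d) :
    HasLineSecondDeriv (fun w => g w - h w) v z (c - d) := by
  obtain ⟨g', hg1, hg2⟩ := hg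
  obtain ⟨h', hh1, hh2⟩ := hh
  refine ⟨fun t => g' t - h' t, ?_, hg2.sub hh2⟩
  filter_upwards [hg1, hh1] with t h1 h2 using h1.sub h2

theorem HasLaplacianAt.sub {g h : ℂ → ℝ} {z : ℂ} {c d : ℝ}
    (hg : HasLaplacianAt g z c) (hh : HasLaplacianAt h z d) :
    HasLaplacianAt (fun w => g w - h w) z (c - d) := by
  obtain ⟨c1, c2, h1, h2, rfl⟩ := hg
  obtain ⟨d1, d2, h3, h4, rfl⟩ := hh
  exact ⟨_, _, h1.sub h3, h2.sub h4, by ring⟩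

theorem HasLineSecondDeriv.nonpos_of_isLocalMax {g : ℂ → ℝ} {v z : ℂ} {c : ℝ}
    (hg : HasLineSecondDeriv g v z c) (hmax : IsLocalMax g z) : c ≤ 0 := by
  obtain ⟨g', hg1, hg2⟩ := hg
  set h : ℝ → ℝ := fun t => g (z + t * v) with hh
  have hlin : Tendsto (fun t : ℝ => z + t * v) (𝓝 0) (𝓝 z) := by
    have : Continuous (fun t : ℝ => z + t * v) := by fun_prop
    simpa using this.tendsto 0
  have hmax' : IsLocalMax h 0 := by
    have := hlin.eventually hmax
    simpa [IsLocalMax, IsMaxFilter, hh] using this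
  have hderiv : deriv h =ᶠ[𝓝 0] g' := hg1.mono fun t ht => ht.deriv
  have hsecond : deriv (deriv h) 0 = c := hderiv.deriv_eq.trans hg2.deriv
  by_contra! hc
  have hmin : IsLocalMin h 0 :=
    isLocalMin_of_deriv_deriv_pos (by rw [hsecond]; exact hc) hmax'.deriv_eq_zero
      hg1.self_of_nhds.continuousAt
  have hconst : h =ᶠ[𝓝 0] fun _ => h 0 := by
    filter_upwards [hmax', hmin] with t h1 h2 using le_antisymm h1 h2
  have : deriv (deriv h) 0 = 0 := by
    rw [hconst.deriv.deriv_eq]; simp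
  linarith

theorem HasLaplacianAt.nonpos_of_isLocalMax {g : ℂ → ℝ} {z : ℂ} {L : ℝ}
    (hg : HasLaplacianAt g z L) (hmax : IsLocalMax g z) : L ≤ 0 := by
  obtain ⟨c, d, h1, h2, rfl⟩ := hg
  linarith [h1.nonpos_of_isLocalMax hmax, h2.nonpos_of_isLocalMax hmax]

/-- The planar Laplacian of a radial function, written in terms of the squared radius. -/
theorem hasLaplacianAt_radial {k k' : ℝ → ℝ} {k'' : ℝ} {p z : ℂ}
    (hk : ∀ᶠ s in 𝓝 (Complex.normSq (z - p)), HasDerivAt k (k' s) s)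
    (hk' : HasDerivAt k' k'' (Complex.normSq (z - p))) :
    HasLaplacianAt (fun w => k (Complex.normSq (w - p))) z
      (4 * Complex.normSq (z - p) * k'' + 4 * k' (Complex.normSq (z - p))) := by
  have hline : ∀ v : ℂ, HasLineSecondDeriv (fun w => k (Complex.normSq (w - p))) v z
      (k'' * (2 * ((z - p).re * v.re + (z - p).im * v.im)) ^ 2
        + k' (Complex.normSq (z - p)) * (2 * Complex.normSq v)) := by
    intro v
    set u : ℝ → ℝ := fun t => Complex.normSq (z + t * v - p) with hu
    set u' : ℝ → ℝ := fun t =>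
      2 * ((z - p).re * v.re + (z - p).im * v.im) + 2 * Complex.normSq v * t with hu'
    have hueq : u = fun t => Complex.normSq (z - p)
        + 2 * ((z - p).re * v.re + (z - p).im * v.im) * t + Complex.normSq v * t ^ 2 := by
      funext t
      simp [hu, Complex.normSq_apply]
      ring
    have hud : ∀ t, HasDerivAt u (u' t) t := by
      intro t
      rw [hueq]
      have h1 := (((hasDerivAt_id t).const_mul
        (2 * ((z - p).re * v.re + (z - p).im * v.im))).const_add (Complex.normSq (z - p))).add
          (((hasDerivAt_id t).pow 2).const_mul (Complex.normSq v))
      refine h1.congr_deriv ?_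
      simp [hu']
      ring
    have hu0 : u 0 = Complex.normSq (z - p) := by simp [hu]
    have hu'd : HasDerivAt u' (2 * Complex.normSq v) 0 := by
      have h1 := ((hasDerivAt_id (0 : ℝ)).const_mul (2 * Complex.normSq v)).const_add
        (2 * ((z - p).re * v.re + (z - p).im * v.im))
      simpa [hu'] using h1
    refine ⟨fun t => k' (u t) * u' t, ?_, ?_⟩
    · have hcont : Tendsto u (𝓝 0) (𝓝 (Complex.normSq (z - p))) := by
        simpa [hu0] using (hud 0).continuousAt.tendsto
      filter_upwards [hcont.eventually hk] with t ht
      exact ht.comp t (hud t)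
    · rw [← hu0] at hk'
      refine ((hk'.comp 0 (hud 0)).mul hu'd).congr_deriv ?_
      simp [hu0, hu']
      ring
  refine ⟨_, _, hline 1, hline Complex.I, ?_⟩
  simp [Complex.normSq_apply]
  ring

/-- Keller–Osserman: a function with `Δw ≥ w²` wherever it is positive is nowhere positive. -/
theorem nonpos_of_sq_le_laplacian {w L : ℂ → ℝ} (hw : Continuous w)
    (hL : ∀ z, HasLaplacianAt w z (L z)) (hsq : ∀ z, 0 < w z → w z ^ 2 ≤ L z) (p : ℂ) :
    w p ≤ 0 := by
  have key : ∀ R : ℝ, 0 < R → w p * R ^ 2 ≤ 24 := by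
    intro R hR
    by_cases hp : w p ≤ 0
    · nlinarith [sq_nonneg R]
    push Not at hp
    set q : ℂ → ℝ := fun z => R ^ 2 - Complex.normSq (z - p) with hq
    have hqc : Continuous q := by
      have := Complex.continuous_normSq
      fun_prop
    have hqdist : ∀ z, q z = R ^ 2 - dist z p ^ 2 := fun z => by
      simp [hq, Complex.normSq_eq_norm_sq, dist_eq_norm]
    obtain ⟨z, hz, hmax⟩ := (isCompact_closedBall p R).exists_isMaxOn
      (Metric.nonempty_closedBall.2 hR.le) (f := fun z => w z * q z ^ 2) (by fun_prop)
    set M := w z * q z ^ 2 with hM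
    have hpM : w p * R ^ 4 ≤ M := by
      have : w p * q p ^ 2 ≤ M := hmax (Metric.mem_closedBall_self hR.le)
      calc w p * R ^ 4 = w p * q p ^ 2 := by simp only [hq, sub_self, map_zero, sub_zero]; ring
        _ ≤ M := this
    have hM0 : 0 < M := lt_of_lt_of_le (by positivity) hpM
    have hqz : 0 < q z := by
      have h0 : 0 ≤ q z := by
        rw [hqdist]
        have := Metric.mem_closedBall.1 hz
        nlinarith [dist_nonneg (x := z) (y := p)]
      refine lt_of_le_of_ne h0 fun h => ?_
      rw [hM, ← h] at hM0
      simp at hM0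
    have hwz : 0 < w z := by
      by_contra! h
      nlinarith [sq_nonneg (q z)]
    have hlap : HasLaplacianAt (fun x => M * (R ^ 2 - Complex.normSq (x - p))⁻¹ ^ 2) z
        (4 * Complex.normSq (z - p) * (6 * M * (q z)⁻¹ ^ 4) + 4 * (2 * M * (q z)⁻¹ ^ 3)) := by
      have hd : ∀ s : ℝ, 0 < R ^ 2 - s →
          HasDerivAt (fun s => (R ^ 2 - s)⁻¹) ((R ^ 2 - s)⁻¹ ^ 2) s := by
        intro s hs
        refine (((hasDerivAt_id s).const_sub (R ^ 2)).fun_inv hs.ne').congr_deriv ?_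
        simp
      refine hasLaplacianAt_radial (k := fun s => M * (R ^ 2 - s)⁻¹ ^ 2)
        (k' := fun s => 2 * M * (R ^ 2 - s)⁻¹ ^ 3) ?_ ?_
      · have : ∀ᶠ s in 𝓝 (Complex.normSq (z - p)), 0 < R ^ 2 - s :=
          (continuous_const.sub continuous_id).continuousAt.eventually (lt_mem_nhds hqz)
        filter_upwards [this] with s hs
        refine (((hd s hs).pow 2).const_mul M).congr_deriv ?_
        push_cast
        ring
      · refine (((hd _ hqz).pow 3).const_mul (2 * M)).congr_deriv ?_
        simp only [hq]
        push_cast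
        ring
    have hloc : IsLocalMax (fun x => w x - M * (R ^ 2 - Complex.normSq (x - p))⁻¹ ^ 2) z := by
      have : ∀ᶠ x in 𝓝 z, 0 < q x := hqc.continuousAt.eventually (lt_mem_nhds hqz)
      filter_upwards [this] with x hx
      have hxb : x ∈ Metric.closedBall p R := by
        rw [hqdist] at hx
        exact Metric.mem_closedBall.2 (abs_le_of_sq_le_sq' (by linarith) hR.le).2
      have h1 : w x * q x ^ 2 ≤ M := hmax hxb
      have h2 : w z - M * (q z)⁻¹ ^ 2 = 0 := by rw [hM]; field_simp; ring
      have h3 : w x ≤ M * (q x)⁻¹ ^ 2 := by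
        rw [inv_pow, ← div_eq_mul_inv, le_div_iff₀ (by positivity)]; exact h1
      change w x - M * (q x)⁻¹ ^ 2 ≤ w z - M * (q z)⁻¹ ^ 2
      linarith
    have hle := ((hL z).sub hlap).nonpos_of_isLocalMax hloc
    have hs := hsq z hwz
    have hMle : M ≤ 24 * R ^ 2 := by
      have hn := Complex.normSq_nonneg (z - p)
      have hqn : q z = R ^ 2 - Complex.normSq (z - p) := rfl
      have h1 : w z ^ 2 * q z ^ 4 = M ^ 2 := by rw [hM]; ring
      have h2 : (4 * Complex.normSq (z - p) * (6 * M * (q z)⁻¹ ^ 4)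
          + 4 * (2 * M * (q z)⁻¹ ^ 3)) * q z ^ 4
          = M * (24 * Complex.normSq (z - p) + 8 * q z) := by field_simp; ring
      have h3 : M ^ 2 ≤ M * (24 * Complex.normSq (z - p) + 8 * q z) := by
        rw [← h1, ← h2]
        exact mul_le_mul_of_nonneg_right (by linarith) (by positivity)
      have h4 : M ≤ 24 * Complex.normSq (z - p) + 8 * q z := by
        rw [sq] at h3
        exact le_of_mul_le_mul_left h3 hM0
      linarith
    have h5 : R ^ 2 * (w p * R ^ 2) ≤ R ^ 2 * 24 := by nlinarith
    exact le_of_mul_le_mul_left h5 (by positivity)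
  by_contra! h
  have := key (√(25 / w p)) (by positivity)
  rw [Real.sq_sqrt (by positivity)] at this
  field_simp at this
  norm_num at this

/-- Strong minimum principle for nonnegative `v` with `Δv ≤ v`. -/
theorem pos_of_laplacian_le_self {v L : ℂ → ℝ} (hv : Continuous v) (h0 : ∀ z, 0 ≤ v z)
    (hL : ∀ z, HasLaplacianAt v z (L z)) (hle : ∀ z, L z ≤ v z) {p : ℂ} (hp : 0 < v p) (x : ℂ) :
    0 < v x := by
  obtain ⟨δ, hδ, hball⟩ := Metric.nhds_basis_closedBall.eventually_iff.1
    (hv.continuousAt.eventually (lt_mem_nhds (half_lt_self hp)) : ∀ᶠ z in 𝓝 p, v p / 2 < v z)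
  rcases le_or_gt (dist x p) δ with hx | hx
  · exact (half_pos hp).trans (hball hx)
  set R := dist x p + 1 with hR
  set α := 1 / δ ^ 2 + 1 with hα
  have hαpos : 0 < α := by positivity
  have hαδ : 1 ≤ 4 * α ^ 2 * δ ^ 2 - 4 * α := by
    have : α * δ ^ 2 = 1 + δ ^ 2 := by rw [hα]; field_simp
    have h2 : 4 * α ^ 2 * δ ^ 2 = 4 * α * (1 + δ ^ 2) := by rw [← this]; ring
    rw [h2]; nlinarith [sq_nonneg δ]
  set ε := v p / 2 with hε
  have hεpos : 0 < ε := half_pos hp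
  set k : ℝ → ℝ := fun s => ε * (Real.exp (-α * s) - Real.exp (-α * R ^ 2)) with hk
  have hnd : ∀ z : ℂ, Complex.normSq (z - p) = dist z p ^ 2 := fun z => by
    simp [Complex.normSq_eq_norm_sq, dist_eq_norm]
  have hkd : ∀ s, HasDerivAt k (-(α * ε) * Real.exp (-α * s)) s := fun s => by
    refine (((((hasDerivAt_id s).const_mul (-α)).exp).sub_const _).const_mul ε).congr_deriv ?_
    simp
    ring
  have hkd' : ∀ s, HasDerivAt (fun s => -(α * ε) * Real.exp (-α * s))
      (α ^ 2 * ε * Real.exp (-α * s)) s := fun s => by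
    refine ((((hasDerivAt_id s).const_mul (-α)).exp).const_mul _).congr_deriv ?_
    simp
    ring
  have hkc : Continuous k := by fun_prop
  set h : ℂ → ℝ := fun z => k (Complex.normSq (z - p)) with hh
  have hhc : Continuous h := hkc.comp (Complex.continuous_normSq.comp (by fun_prop))
  set K : Set ℂ := Metric.closedBall p R ∩ {z | δ ≤ dist z p} with hK
  have hKc : IsCompact K := (isCompact_closedBall p R).inter_right
    (isClosed_le continuous_const (by fun_prop))
  have hxK : x ∈ K := ⟨Metric.mem_closedBall.2 (by linarith), hx.le⟩
  obtain ⟨z, hz, hmax⟩ := hKc.exists_isMaxOn ⟨x, hxK⟩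
    (f := fun z => h z - v z) (hhc.sub hv).continuousOn
  have hcomp : h z - v z ≤ 0 := by
    by_contra! hneg
    have hzR : dist z p < R := by
      refine lt_of_le_of_ne (Metric.mem_closedBall.1 hz.1) fun he => ?_
      have : h z = 0 := by simp [hh, hk, hnd, he]
      linarith [h0 z]
    have hzδ : δ < dist z p := by
      refine lt_of_le_of_ne hz.2 fun he => ?_
      have h1 : ε < v z := hball (Metric.mem_closedBall.2 he.ge)
      have h2 : h z ≤ ε := by
        have : Real.exp (-α * Complex.normSq (z - p)) ≤ 1 := by
          rw [Real.exp_le_one_iff]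
          nlinarith [Complex.normSq_nonneg (z - p)]
        simp only [hh, hk]
        nlinarith [Real.exp_pos (-α * R ^ 2)]
      linarith
    have hKn : K ∈ 𝓝 z := by
      have hc : Continuous fun w : ℂ => dist w p := by fun_prop
      filter_upwards [hc.continuousAt.eventually (lt_mem_nhds hzδ),
        hc.continuousAt.eventually (gt_mem_nhds hzR)] with w h1 h2
      exact ⟨Metric.mem_closedBall.2 h2.le, h1.le⟩
    have hlap := (hasLaplacianAt_radial (p := p) (z := z) (Eventually.of_forall hkd)
      (hkd' _)).sub (hL z)
    have hlapn := hlap.nonpos_of_isLocalMax (hmax.isLocalMax hKn)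
    have hhle : h z ≤ 4 * Complex.normSq (z - p) *
        (α ^ 2 * ε * Real.exp (-α * Complex.normSq (z - p)))
        + 4 * (-(α * ε) * Real.exp (-α * Complex.normSq (z - p))) := by
      set E := Real.exp (-α * Complex.normSq (z - p)) with hE
      have hEpos : 0 < E := Real.exp_pos _
      have hs : δ ^ 2 ≤ Complex.normSq (z - p) := by
        rw [hnd]; exact pow_le_pow_left₀ hδ.le hzδ.le 2
      have h1 : 1 ≤ 4 * α ^ 2 * Complex.normSq (z - p) - 4 * α := by
        nlinarith [mul_le_mul_of_nonneg_left hs (sq_nonneg α)]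
      have h2 : h z ≤ ε * E := by
        simp only [hh, hk, ← hE]
        nlinarith [Real.exp_pos (-α * R ^ 2)]
      nlinarith [mul_le_mul_of_nonneg_left h1 (mul_pos hεpos hEpos).le]
    linarith [hle z]
  have hxle : h x - v x ≤ 0 := (hmax hxK).trans hcomp
  have hhx : 0 < h x := by
    have : Real.exp (-α * R ^ 2) < Real.exp (-α * dist x p ^ 2) := by
      rw [Real.exp_lt_exp]
      have : dist x p ^ 2 < R ^ 2 := by rw [hR]; nlinarith [dist_nonneg (x := x) (y := p)]
      nlinarith
    simp only [hh, hk, hnd]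
    exact mul_pos hεpos (by linarith)
  linarith

theorem hasDerivAt_comp_line {g : ℂ → ℝ} (hg : Differentiable ℝ g) (z v : ℂ) (t : ℝ) :
    HasDerivAt (fun t : ℝ => g (z + t * v)) (fderiv ℝ g (z + t * v) v) t := by
  have h1 : HasDerivAt (fun t : ℝ => z + t * v) v t := by
    simpa using ((Complex.ofRealCLM.hasDerivAt (x := t)).mul_const v).const_add z
  exact (hg (z + t * v)).hasFDerivAt.comp_hasDerivAt t h1

theorem contDiff_fderiv_apply {g : ℂ → ℝ} (hg : ContDiff ℝ (⊤ : ℕ∞) g) (v : ℂ) :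
    ContDiff ℝ (⊤ : ℕ∞) (fun w => fderiv ℝ g w v) :=
  (hg.fderiv_right (by simp)).clm_apply contDiff_const

theorem HasLineSecondDeriv.sq_add_sq {a b : ℂ → ℝ} (ha : ContDiff ℝ (⊤ : ℕ∞) a)
    (hb : ContDiff ℝ (⊤ : ℕ∞) b) (v z : ℂ) :
    HasLineSecondDeriv (fun w => a w ^ 2 + b w ^ 2) v z
      (2 * (fderiv ℝ a z v ^ 2 + a z * fderiv ℝ (fun w => fderiv ℝ a w v) z v
        + fderiv ℝ b z v ^ 2 + b z * fderiv ℝ (fun w => fderiv ℝ b w v) z v)) := by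
  have hda := hasDerivAt_comp_line (ha.differentiable (by simp)) z v
  have hdb := hasDerivAt_comp_line (hb.differentiable (by simp)) z v
  have hda' := hasDerivAt_comp_line ((contDiff_fderiv_apply ha v).differentiable (by simp)) z v 0
  have hdb' := hasDerivAt_comp_line ((contDiff_fderiv_apply hb v).differentiable (by simp)) z v 0
  refine ⟨fun t => 2 * (a (z + t * v) * fderiv ℝ a (z + t * v) v
      + b (z + t * v) * fderiv ℝ b (z + t * v) v), Eventually.of_forall fun t => ?_, ?_⟩
  · refine (((hda t).pow 2).add ((hdb t).pow 2)).congr_deriv ?_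
    push_cast
    ring
  · refine ((((hda 0).mul hda').add ((hdb 0).mul hdb')).const_mul 2).congr_deriv ?_
    simp only [Complex.ofReal_zero, zero_mul, add_zero]
    ring

theorem fderiv_fderiv_apply_comm {g : ℂ → ℝ} (hg : ContDiff ℝ (⊤ : ℕ∞) g) (z u v : ℂ) :
    fderiv ℝ (fun w => fderiv ℝ g w u) z v = fderiv ℝ (fun w => fderiv ℝ g w v) z u := by
  have hd : DifferentiableAt ℝ (fderiv ℝ g) z :=
    ((hg.fderiv_right (m := (⊤ : ℕ∞)) (by simp)).differentiable (by simp)) z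
  have hs : IsSymmSndFDerivAt ℝ g z :=
    hg.contDiffAt.isSymmSndFDerivAt (by
      rw [minSmoothness_of_isRCLikeNormedField]; exact WithTop.coe_le_coe.2 le_top)
  have hfd : ∀ u : ℂ, fderiv ℝ (fun w => fderiv ℝ g w u) z = (fderiv ℝ (fderiv ℝ g) z).flip u := by
    intro u
    simpa using (hd.hasFDerivAt.clm_apply (hasFDerivAt_const u z)).fderiv
  rw [hfd, hfd]
  exact hs.eq v u

theorem fderiv_apply_of_eq_mul_add_add_mul {G g₁ h₁ k g₂ h₂ : ℂ → ℝ} {c₁ c₂ c₃ : ℝ}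
    (hg₁ : Differentiable ℝ g₁) (hh₁ : Differentiable ℝ h₁) (hk : Differentiable ℝ k)
    (hg₂ : Differentiable ℝ g₂) (hh₂ : Differentiable ℝ h₂)
    (hG : ∀ w, G w = c₁ * (g₁ w * h₁ w) + c₂ * k w + c₃ * (g₂ w * h₂ w)) (z v : ℂ) :
    fderiv ℝ G z v = c₁ * (g₁ z * fderiv ℝ h₁ z v + h₁ z * fderiv ℝ g₁ z v)
      + c₂ * fderiv ℝ k z v + c₃ * (g₂ z * fderiv ℝ h₂ z v + h₂ z * fderiv ℝ g₂ z v) := by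
  have h1 := (hg₁ z).hasFDerivAt.mul (hh₁ z).hasFDerivAt
  have h2 := (hg₂ z).hasFDerivAt.mul (hh₂ z).hasFDerivAt
  have h := ((h1.const_mul c₁).add ((hk z).hasFDerivAt.const_mul c₂)).add (h2.const_mul c₃)
  rw [funext hG]
  exact (DFunLike.congr_fun h.fderiv v).trans (by simp [mul_add])

/-- For a vortex, `ρ = |f|²` satisfies `Δρ = (ρ - 1)ρ + 2(|∂ₛf + iφf|² + |∂ₜf + iψf|²)`. -/
theorem vortex_hasLaplacianAt_norm_sq {φ ψ : ℂ → ℝ} {f : ℂ → ℂ}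
    (hφ : ContDiff ℝ (⊤ : ℕ∞) φ) (hψ : ContDiff ℝ (⊤ : ℕ∞) ψ) (hf : ContDiff ℝ (⊤ : ℕ∞) f)
    (heq1 : ∀ z : ℂ, (fderiv ℝ f z 1 + Complex.I * (φ z : ℂ) * f z)
      + Complex.I * (fderiv ℝ f z Complex.I + Complex.I * (ψ z : ℂ) * f z) = 0)
    (heq2 : ∀ z : ℂ, fderiv ℝ ψ z 1 - fderiv ℝ φ z Complex.I + (1 - ‖f z‖ ^ 2) / 2 = 0) (z : ℂ) :
    HasLaplacianAt (fun w => ‖f w‖ ^ 2) z ((‖f z‖ ^ 2 - 1) * ‖f z‖ ^ 2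
      + 2 * (‖fderiv ℝ f z 1 + Complex.I * (φ z : ℂ) * f z‖ ^ 2
        + ‖fderiv ℝ f z Complex.I + Complex.I * (ψ z : ℂ) * f z‖ ^ 2)) := by
  set a : ℂ → ℝ := fun w => (f w).re with ha_def
  set b : ℂ → ℝ := fun w => (f w).im with hb_def
  have ha : ContDiff ℝ (⊤ : ℕ∞) a := Complex.reCLM.contDiff.comp hf
  have hb : ContDiff ℝ (⊤ : ℕ∞) b := Complex.imCLM.contDiff.comp hf
  have hfd : ∀ w, DifferentiableAt ℝ f w := hf.differentiable (by simp)
  have hre : ∀ w v, (fderiv ℝ f w v).re = fderiv ℝ a w v := fun w v => by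
    have := (Complex.reCLM.hasFDerivAt.comp w (hfd w).hasFDerivAt).fderiv
    exact (DFunLike.congr_fun this v).symm
  have him : ∀ w v, (fderiv ℝ f w v).im = fderiv ℝ b w v := fun w v => by
    have := (Complex.imCLM.hasFDerivAt.comp w (hfd w).hasFDerivAt).fderiv
    exact (DFunLike.congr_fun this v).symm
  have hnorm : ∀ w, ‖f w‖ ^ 2 = a w ^ 2 + b w ^ 2 := fun w => by
    rw [Complex.sq_norm, Complex.normSq_apply]; ring
  have da := ha.differentiable (by simp)
  have db := hb.differentiable (by simp)
  have dφ := hφ.differentiable (by simp)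
  have dψ := hψ.differentiable (by simp)
  have da' := fun v => (contDiff_fderiv_apply ha v).differentiable (by simp)
  have db' := fun v => (contDiff_fderiv_apply hb v).differentiable (by simp)
  have eR : ∀ w, fderiv ℝ a w 1 - φ w * b w - fderiv ℝ b w Complex.I - ψ w * a w = 0 := fun w => by
    have := congrArg Complex.re (heq1 w)
    simp [hre, him] at this
    linarith
  have eI : ∀ w, fderiv ℝ b w 1 + φ w * a w + fderiv ℝ a w Complex.I - ψ w * b w = 0 := fun w => by
    have := congrArg Complex.im (heq1 w)
    simp [hre, him] at this
    linarith
  have eR1 := fderiv_apply_of_eq_mul_add_add_mul (c₁ := 1) (c₂ := 1) (c₃ := 1)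
    dφ db (db' Complex.I) dψ da (fun w => by linarith [eR w] :
      ∀ w, fderiv ℝ a w 1 = 1 * (φ w * b w) + 1 * fderiv ℝ b w Complex.I + 1 * (ψ w * a w)) z 1
  have eRI := fderiv_apply_of_eq_mul_add_add_mul (c₁ := -1) (c₂ := 1) (c₃ := -1)
    dφ db (da' 1) dψ da (fun w => by linarith [eR w] :
      ∀ w, fderiv ℝ b w Complex.I = -1 * (φ w * b w) + 1 * fderiv ℝ a w 1 + -1 * (ψ w * a w)) z Complex.I
  have eI1 := fderiv_apply_of_eq_mul_add_add_mul (c₁ := 1) (c₂ := -1) (c₃ := -1)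
    dψ db (da' Complex.I) dφ da (fun w => by linarith [eI w] :
      ∀ w, fderiv ℝ b w 1 = 1 * (ψ w * b w) + -1 * fderiv ℝ a w Complex.I + -1 * (φ w * a w)) z 1
  have eII := fderiv_apply_of_eq_mul_add_add_mul (c₁ := 1) (c₂ := -1) (c₃ := -1)
    dψ db (db' 1) dφ da (fun w => by linarith [eI w] :
      ∀ w, fderiv ℝ a w Complex.I = 1 * (ψ w * b w) + -1 * fderiv ℝ b w 1 + -1 * (φ w * a w)) z Complex.I
  have hF := heq2 z
  rw [hnorm] at hF
  simp only [hnorm]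
  refine ⟨_, _, HasLineSecondDeriv.sq_add_sq ha hb 1 z,
    HasLineSecondDeriv.sq_add_sq ha hb Complex.I z, ?_⟩
  rw [eR1, eRI, eI1, eII, fderiv_fderiv_apply_comm ha z 1 Complex.I,
    fderiv_fderiv_apply_comm hb z 1 Complex.I]
  simp only [Complex.sq_norm, Complex.normSq_apply, Complex.add_re, Complex.add_im, hre, him]
  simp only [Complex.mul_re, Complex.mul_im, Complex.I_re, Complex.I_im, Complex.ofReal_re,
    Complex.ofReal_im]
  have hR := eR z
  have hI := eI z
  linear_combination 2 * (ψ z * a z + φ z * b z) * hR + 2 * (ψ z * b z - φ z * a z) * hI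
    + 2 * (a z ^ 2 + b z ^ 2) * hF

/-- Let `(φ, ψ, f)` be a vortex over `ℂ` in the Ginzburg–Landau setting, i.e. smooth functions
`φ, ψ : ℂ → ℝ`, `f : ℂ → ℂ` satisfying `∂ₛf + iφf + i(∂ₜf + iψf) = 0` and
`∂ₛψ - ∂ₜφ + (1 - |f|²)/2 = 0`, whose energy `E = ∫_ℂ e` is finite and positive. Then
`|f(z)| < 1` for every `z ∈ ℂ`. -/
theorem vortex_image_in_unit_ball (φ ψ : ℂ → ℝ) (f : ℂ → ℂ)
    (hφ : ContDiff ℝ (⊤ : ℕ∞) φ) (hψ : ContDiff ℝ (⊤ : ℕ∞) ψ) (hf : ContDiff ℝ (⊤ : ℕ∞) f)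
    (heq1 : ∀ z : ℂ, (fderiv ℝ f z 1 + Complex.I * (φ z : ℂ) * f z)
      + Complex.I * (fderiv ℝ f z Complex.I + Complex.I * (ψ z : ℂ) * f z) = 0)
    (heq2 : ∀ z : ℂ, fderiv ℝ ψ z 1 - fderiv ℝ φ z Complex.I + (1 - ‖f z‖ ^ 2) / 2 = 0)
    (hfin : ∫⁻ z : ℂ, ENNReal.ofReal (glEnergyDensity φ ψ f z) < ⊤)
    (hpos : 0 < ∫⁻ z : ℂ, ENNReal.ofReal (glEnergyDensity φ ψ f z)) :
    ∀ z : ℂ, ‖f z‖ < 1 := by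
  set N : ℂ → ℝ := fun z => ‖fderiv ℝ f z 1 + Complex.I * (φ z : ℂ) * f z‖ ^ 2
    + ‖fderiv ℝ f z Complex.I + Complex.I * (ψ z : ℂ) * f z‖ ^ 2 with hN
  have hN0 : ∀ z, 0 ≤ N z := fun z => by positivity
  have hlap : ∀ z, HasLaplacianAt (fun w => ‖f w‖ ^ 2) z ((‖f z‖ ^ 2 - 1) * ‖f z‖ ^ 2 + 2 * N z) :=
    vortex_hasLaplacianAt_norm_sq hφ hψ hf heq1 heq2
  have hcont : Continuous fun w => ‖f w‖ ^ 2 := hf.continuous.norm.pow 2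
  have hconst : ∀ z, HasLaplacianAt (fun _ => (1 : ℝ)) z 0 := fun z => by
    simpa using hasLaplacianAt_radial (k := fun _ => 1) (k' := fun _ => 0) (k'' := 0) (p := 0)
      (z := z) (Eventually.of_forall fun s => hasDerivAt_const s 1) (hasDerivAt_const _ 0)
  have hle : ∀ z, ‖f z‖ ^ 2 ≤ 1 := fun z => by
    have := nonpos_of_sq_le_laplacian (w := fun z => ‖f z‖ ^ 2 - 1) (hcont.sub continuous_const)
      (fun z => (hlap z).sub (hconst z)) (fun z hz => by nlinarith [hN0 z]) z
    linarith
  intro x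
  by_contra! hx
  have hx1 : ‖f x‖ ^ 2 = 1 := le_antisymm (hle x) (one_le_pow₀ hx)
  have hone : ∀ z, ‖f z‖ ^ 2 = 1 := by
    by_contra! hne
    obtain ⟨p, hp⟩ := hne
    have := pos_of_laplacian_le_self (v := fun z => 1 - ‖f z‖ ^ 2) (continuous_const.sub hcont)
      (fun z => sub_nonneg.2 (hle z)) (fun z => (hconst z).sub (hlap z))
      (fun z => by nlinarith [hN0 z, hle z, sq_nonneg ‖f z‖, sq_nonneg (1 - ‖f z‖ ^ 2)])
      (sub_pos.2 (lt_of_le_of_ne (hle p) hp)) x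
    linarith
  have henergy : ∀ z, glEnergyDensity φ ψ f z = 0 := fun z => by
    have hmax : IsLocalMax (fun w => ‖f w‖ ^ 2) z :=
      Eventually.of_forall fun w => by simp only [hone, le_refl]
    have h1 := (hlap z).nonpos_of_isLocalMax hmax
    have h2 := heq2 z
    rw [hone] at h1 h2
    have h3 : N z = 0 := by linarith [hN0 z]
    have h4 : fderiv ℝ ψ z 1 - fderiv ℝ φ z Complex.I = 0 := by linarith
    simp only [glEnergyDensity, h4, hone]
    simp only [hN] at h3
    rw [h3]
    norm_num
  simp [henergy] at hpos
end

section
/- Let (φ,ψ,f) be a vortex over ℂ in the Ginzburg–Landau setting whose energy E is finite and positive. Then the image of f contains the open unit ball B₁ ⊆ ℂ: for every w ∈ ℂ with |w| < 1 there exists z ∈ ℂ with f(z) = w. -/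
open MeasureTheory
open scoped ENNReal

theorem contDiff_circleMap_zero {n : WithTop ℕ∞} :
    ContDiff ℝ n (fun p : ℝ × ℝ => circleMap 0 p.1 p.2) := by
  have h (L : ℝ × ℝ →L[ℝ] ℝ) : ContDiff ℝ n (fun p : ℝ × ℝ => ((L p : ℝ) : ℂ)) :=
    Complex.ofRealCLM.contDiff.comp L.contDiff
  simp only [circleMap_zero]
  exact (h (.fst ℝ ℝ ℝ)).mul ((h (.snd ℝ ℝ ℝ)).mul contDiff_const).cexp

theorem hasDerivAt_circleMap_radius (r θ : ℝ) :
    HasDerivAt (fun ρ : ℝ => circleMap 0 ρ θ) (Complex.exp (θ * Complex.I)) r := by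
  simp only [circleMap_zero]
  simpa using (Complex.ofRealCLM.hasDerivAt (x := r)).mul_const (Complex.exp (θ * Complex.I))

theorem fderiv_apply_complex {g : ℂ → ℂ} (z v : ℂ) :
    fderiv ℝ g z v = v.re * fderiv ℝ g z 1 + v.im * fderiv ℝ g z Complex.I := by
  have hv : v = v.re • (1 : ℂ) + v.im • Complex.I := by
    simp
  conv_lhs => rw [hv]
  rw [map_add, map_smul, map_smul, Complex.real_smul, Complex.real_smul]

theorem exp_ofReal_mul_I_eq (θ : ℝ) :
    Complex.exp (θ * Complex.I) = ⟨Real.cos θ, Real.sin θ⟩ := by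
  apply Complex.ext <;> simp [Complex.exp_re, Complex.exp_im]

theorem hasDerivAt_comp_circleMap {g : ℂ → ℂ} (hg : ContDiff ℝ 1 g) (r θ : ℝ) :
    HasDerivAt (fun t : ℝ => g (circleMap 0 r t))
      (-((r * Real.sin θ : ℝ) : ℂ) * fderiv ℝ g (circleMap 0 r θ) 1
        + ((r * Real.cos θ : ℝ) : ℂ) * fderiv ℝ g (circleMap 0 r θ) Complex.I) θ := by
  have := (hg.differentiable one_ne_zero _).hasFDerivAt.comp_hasDerivAt θ
    (hasDerivAt_circleMap 0 r θ)
  rw [fderiv_apply_complex, circleMap_zero, exp_ofReal_mul_I_eq] at this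
  simpa [circleMap_zero, exp_ofReal_mul_I_eq, Function.comp_def] using this

/-- **Green's theorem** on the disc of radius `R`, in polar coordinates. -/
theorem integral_curl_polar {P Q : ℂ → ℂ} (hP : ContDiff ℝ 1 P) (hQ : ContDiff ℝ 1 Q) (R : ℝ) :
    ∫ r in (0 : ℝ)..R, ∫ θ in (-Real.pi)..Real.pi, (r : ℂ) *
      (fderiv ℝ Q (circleMap 0 r θ) 1 - fderiv ℝ P (circleMap 0 r θ) Complex.I) =
    ∫ θ in (-Real.pi)..Real.pi, (R : ℂ) *
      (-(Real.sin θ : ℂ) * P (circleMap 0 R θ) + (Real.cos θ : ℂ) * Q (circleMap 0 R θ)) := by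
  have hsin : ContDiff ℝ 1 (fun p : ℝ × ℝ => ((Real.sin p.2 : ℝ) : ℂ)) :=
    Complex.ofRealCLM.contDiff.comp (Real.contDiff_sin.comp contDiff_snd)
  have hcos : ContDiff ℝ 1 (fun p : ℝ × ℝ => ((Real.cos p.2 : ℝ) : ℂ)) :=
    Complex.ofRealCLM.contDiff.comp (Real.contDiff_cos.comp contDiff_snd)
  have hr : ContDiff ℝ 1 (fun p : ℝ × ℝ => (p.1 : ℂ)) :=
    Complex.ofRealCLM.contDiff.comp contDiff_fst
  have hPc := hP.comp (contDiff_circleMap_zero (n := 1))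
  have hQc := hQ.comp (contDiff_circleMap_zero (n := 1))
  set a : ℝ × ℝ → ℂ := fun p => (p.1 : ℂ) * (-(Real.sin p.2 : ℂ) * P (circleMap 0 p.1 p.2)
    + (Real.cos p.2 : ℂ) * Q (circleMap 0 p.1 p.2)) with ha
  set b : ℝ × ℝ → ℂ := fun p => -((Real.cos p.2 : ℂ) * P (circleMap 0 p.1 p.2)
    + (Real.sin p.2 : ℂ) * Q (circleMap 0 p.1 p.2)) with hb
  have ha1 : ContDiff ℝ 1 a := hr.mul ((hsin.neg.mul hPc).add (hcos.mul hQc))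
  have hb1 : ContDiff ℝ 1 b := ((hcos.mul hPc).add (hsin.mul hQc)).neg
  have key := integral2_divergence_prod_of_hasFDerivAt a b (fderiv ℝ a) (fderiv ℝ b)
    0 (-Real.pi) R Real.pi ha1.continuous.continuousOn hb1.continuous.continuousOn
    (fun x _ => (ha1.differentiable one_ne_zero x).hasFDerivAt)
    (fun x _ => (hb1.differentiable one_ne_zero x).hasFDerivAt)
    (ContinuousOn.integrableOn_compact (isCompact_uIcc.prod isCompact_uIcc)
      (((ha1.continuous_fderiv one_ne_zero).clm_apply continuous_const).add
        ((hb1.continuous_fderiv one_ne_zero).clm_apply continuous_const)).continuousOn)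
  have hb0 : ∀ x, b (x, Real.pi) = b (x, -Real.pi) := by
    intro x
    have : circleMap 0 x Real.pi = circleMap 0 x (-Real.pi) := by
      have := periodic_circleMap 0 x (-Real.pi)
      rw [← this]; ring_nf
    simp [hb, this]
  have ha0 : ∀ y, a (0, y) = 0 := fun y => by simp [ha]
  simp only [hb0, ha0, sub_self, zero_add, intervalIntegral.integral_zero, sub_zero] at key
  rw [← key]
  congr 1; ext r
  congr 1; ext θ
  have hcs : (Real.cos θ : ℂ) ^ 2 + (Real.sin θ : ℂ) ^ 2 = 1 := by
    exact_mod_cast Real.cos_sq_add_sin_sq θ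
  have h1 (g : ℂ → ℂ) (hg : ContDiff ℝ 1 g) : HasDerivAt (fun ρ : ℝ => g (circleMap 0 ρ θ))
      ((Real.cos θ : ℂ) * fderiv ℝ g (circleMap 0 r θ) 1
        + (Real.sin θ : ℂ) * fderiv ℝ g (circleMap 0 r θ) Complex.I) r := by
    have := (hg.differentiable one_ne_zero _).hasFDerivAt.comp_hasDerivAt r
      (hasDerivAt_circleMap_radius r θ)
    rwa [fderiv_apply_complex, exp_ofReal_mul_I_eq] at this
  have hA : HasDerivAt (fun ρ : ℝ => a (ρ, θ)) (fderiv ℝ a (r, θ) (1, 0)) r :=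
    (ha1.differentiable one_ne_zero (r, θ)).hasFDerivAt.comp_hasDerivAt (x := r)
      (f := fun ρ => (ρ, θ))
      ((hasDerivAt_id r).prodMk (hasDerivAt_const r θ))
  have hB : HasDerivAt (fun t : ℝ => b (r, t)) (fderiv ℝ b (r, θ) (0, 1)) θ :=
    (hb1.differentiable one_ne_zero (r, θ)).hasFDerivAt.comp_hasDerivAt (x := θ)
      (f := fun t => (r, t))
      ((hasDerivAt_const θ r).prodMk (hasDerivAt_id θ))
  have hA' := (Complex.ofRealCLM.hasDerivAt (x := r)).mul
    (((h1 P hP).const_mul (-(Real.sin θ : ℂ))).add ((h1 Q hQ).const_mul (Real.cos θ : ℂ)))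
  have hB' := (((Real.hasDerivAt_cos θ).ofReal_comp.mul (hasDerivAt_comp_circleMap hP r θ)).add
    ((Real.hasDerivAt_sin θ).ofReal_comp.mul (hasDerivAt_comp_circleMap hQ r θ))).neg
  rw [hA.unique hA', hB.unique hB']
  simp only [Complex.ofRealCLM_apply, Complex.ofReal_neg, Complex.ofReal_mul, Complex.ofReal_one]
  set p1 := fderiv ℝ P (circleMap 0 r θ) 1
  set p2 := fderiv ℝ P (circleMap 0 r θ) Complex.I
  set q1 := fderiv ℝ Q (circleMap 0 r θ) 1
  set q2 := fderiv ℝ Q (circleMap 0 r θ) Complex.I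
  simp only [Pi.add_apply]
  linear_combination (-(r : ℂ) * (q1 - p2)) * hcs

/-- A closed curve outside the disc of radius `‖w‖` winds equally often around `w` and `0`. -/
theorem integral_div_sub_sub_div_eq_zero {f f' : ℝ → ℂ} {a b : ℝ} {w : ℂ}
    (hf : ∀ t, HasDerivAt f (f' t) t) (hf' : Continuous f') (hab : f a = f b)
    (hw : ∀ t ∈ Set.uIcc a b, ‖w‖ < ‖f t‖) :
    ∫ t in a..b, (f' t / (f t - w) - f' t / f t) = 0 := by
  have hfc : Continuous f := continuous_iff_continuousAt.2 fun t => (hf t).continuousAt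
  have h0 : ∀ t ∈ Set.uIcc a b, f t ≠ 0 := fun t ht =>
    norm_pos_iff.1 ((norm_nonneg w).trans_lt (hw t ht))
  have h1 : ∀ t ∈ Set.uIcc a b, f t - w ≠ 0 := fun t ht h =>
    (hw t ht).ne' (by rw [sub_eq_zero.1 h])
  have hderiv : ∀ t ∈ Set.uIcc a b, HasDerivAt (fun t => Complex.log (1 - w / f t))
      (f' t / (f t - w) - f' t / f t) t := by
    intro t ht
    have hlt : ‖w / f t‖ < 1 := by
      rw [norm_div, div_lt_one (norm_pos_iff.2 (h0 t ht))]
      exact hw t ht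
    have hslit : 1 - w / f t ∈ Complex.slitPlane := by
      left
      have := (Complex.re_le_norm (w / f t)).trans_lt hlt
      simpa using this
    have := ((((hasDerivAt_const t w).fun_div (hf t) (h0 t ht))).const_sub 1).clog_real hslit
    refine this.congr_deriv ?_
    have e0 := h0 t ht
    have e1 := h1 t ht
    have e2 : 1 - w / f t = (f t - w) / f t := by field_simp
    rw [e2]
    field_simp
    ring
  rw [intervalIntegral.integral_eq_sub_of_hasDerivAt hderiv, hab, sub_self]
  refine ContinuousOn.intervalIntegrable (ContinuousOn.sub ?_ ?_)
  · exact hf'.continuousOn.div (hfc.sub continuous_const).continuousOn h1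
  · exact hf'.continuousOn.div hfc.continuousOn h0

/-- If the covariant derivative `D` of a curve `f` and the deviation of `‖f‖²` from `1` are small
in `L²`, then `‖f‖²` is uniformly close to `1`. -/
theorem abs_one_sub_norm_sq_le {f D : ℝ → ℂ} {α : ℝ → ℝ} {η : ℝ} (hη : 0 < η) (hη1 : η ≤ 1)
    (hD : Continuous D)
    (hf : ∀ t, HasDerivAt f (D t - Complex.I * α t * f t) t)
    (hDη : ∫ t in (-Real.pi)..Real.pi, ‖D t‖ ^ 2 ≤ 2 * η ^ 2)
    (hfη : ∫ t in (-Real.pi)..Real.pi, (1 - ‖f t‖ ^ 2) ^ 2 ≤ 8 * η ^ 2) :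
    ∀ t ∈ Set.Icc (-Real.pi) Real.pi, |1 - ‖f t‖ ^ 2| ≤ 18 * η := by
  have hfc : Continuous f := continuous_iff_continuousAt.2 fun t => (hf t).continuousAt
  have hpi := Real.pi_pos
  have hle : -Real.pi ≤ Real.pi := by linarith
  obtain ⟨s, hs, hsη⟩ : ∃ s ∈ Set.Icc (-Real.pi) Real.pi, |1 - ‖f s‖ ^ 2| ≤ 2 * η := by
    by_contra! h
    have hmono : ∫ t in (-Real.pi)..Real.pi, (2 * η) ^ 2
        ≤ ∫ t in (-Real.pi)..Real.pi, (1 - ‖f t‖ ^ 2) ^ 2 := by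
      refine intervalIntegral.integral_mono_on hle (continuous_const.intervalIntegrable _ _)
        (Continuous.intervalIntegrable (by fun_prop) _ _) fun t ht => ?_
      exact sq_le_sq' (by linarith [h t ht, abs_nonneg (1 - ‖f t‖ ^ 2)]) (h t ht).le |>.trans
        (sq_abs _).le
    rw [intervalIntegral.integral_const, smul_eq_mul] at hmono
    nlinarith [Real.pi_gt_three, sq_pos_of_pos hη]
  have hderiv : ∀ t, HasDerivAt (fun t => ‖f t‖ ^ 2) (2 * inner ℝ (f t) (D t)) t := by
    intro t
    refine (hf t).norm_sq.congr_deriv ?_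
    simp [Complex.inner]
    ring
  set B : ℝ → ℝ := fun t => η * (3 / 2 + (1 - ‖f t‖ ^ 2) ^ 2 / 2) + ‖D t‖ ^ 2 / η with hB
  have hBc : Continuous B := by fun_prop
  have hbound : ∀ t, ‖2 * inner ℝ (f t) (D t)‖ ≤ B t := by
    intro t
    rw [norm_mul, Real.norm_ofNat, Real.norm_eq_abs]
    have h1 := abs_real_inner_le_norm (f t) (D t)
    have h2 : 2 * (‖f t‖ * ‖D t‖) ≤ η * ‖f t‖ ^ 2 + ‖D t‖ ^ 2 / η := by
      have : η * ‖f t‖ ^ 2 + ‖D t‖ ^ 2 / η - 2 * (‖f t‖ * ‖D t‖)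
          = (η * ‖f t‖ - ‖D t‖) ^ 2 / η := by
        field_simp
        ring
      have : 0 ≤ (η * ‖f t‖ - ‖D t‖) ^ 2 / η := by positivity
      linarith
    have h3 : ‖f t‖ ^ 2 ≤ 3 / 2 + (1 - ‖f t‖ ^ 2) ^ 2 / 2 := by
      nlinarith [sq_nonneg (2 - ‖f t‖ ^ 2)]
    have := mul_le_mul_of_nonneg_left h3 hη.le
    simp only [hB]
    linarith
  have hBint : ∫ t in (-Real.pi)..Real.pi, B t ≤ 16 * η := by
    have i1 : IntervalIntegrable (fun t => (1 - ‖f t‖ ^ 2) ^ 2) volume (-Real.pi) Real.pi :=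
      Continuous.intervalIntegrable (by fun_prop) _ _
    have i2 : IntervalIntegrable (fun t => ‖D t‖ ^ 2) volume (-Real.pi) Real.pi :=
      Continuous.intervalIntegrable (by fun_prop) _ _
    have i3 : IntervalIntegrable (fun _ => (3 / 2 : ℝ)) volume (-Real.pi) Real.pi :=
      continuous_const.intervalIntegrable _ _
    simp only [hB]
    rw [intervalIntegral.integral_add ((i3.add (i1.div_const 2)).const_mul η) (i2.div_const η),
      intervalIntegral.integral_const_mul, intervalIntegral.integral_add i3 (i1.div_const 2),
      intervalIntegral.integral_const, smul_eq_mul, intervalIntegral.integral_div,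
      intervalIntegral.integral_div]
    have h1 : (∫ t in (-Real.pi)..Real.pi, ‖D t‖ ^ 2) / η ≤ 2 * η := by
      rw [div_le_iff₀ hη]; linarith
    have h2 : η * ((Real.pi - -Real.pi) * (3 / 2)
        + (∫ t in (-Real.pi)..Real.pi, (1 - ‖f t‖ ^ 2) ^ 2) / 2) ≤ η * 14 := by
      refine mul_le_mul_of_nonneg_left ?_ hη.le
      nlinarith [Real.pi_lt_d2]
    linarith
  intro t ht
  have hdiff : |‖f t‖ ^ 2 - ‖f s‖ ^ 2| ≤ 16 * η := by
    rw [← intervalIntegral.integral_eq_sub_of_hasDerivAt (fun u _ => hderiv u)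
      (Continuous.intervalIntegrable (by fun_prop) _ _)]
    refine le_trans (intervalIntegral.norm_integral_le_abs_of_norm_le
      (Filter.Eventually.of_forall fun u => hbound u) (hBc.intervalIntegrable _ _)) ?_
    refine le_trans ?_ hBint
    have hB0 : ∀ u, 0 ≤ B u := fun u => (norm_nonneg _).trans (hbound u)
    refine (intervalIntegral.abs_integral_mono_interval ?_
      (Filter.Eventually.of_forall hB0) (hBc.intervalIntegrable _ _)).trans
        (abs_of_nonneg (intervalIntegral.integral_nonneg hle fun u _ => hB0 u)).le
    rw [Set.uIoc_of_le hle]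
    exact Set.Ioc_subset_Ioc (le_min hs.1 ht.1) (max_le hs.2 ht.2)
  calc |1 - ‖f t‖ ^ 2| = |(1 - ‖f s‖ ^ 2) - (‖f t‖ ^ 2 - ‖f s‖ ^ 2)| := by ring_nf
    _ ≤ |1 - ‖f s‖ ^ 2| + |‖f t‖ ^ 2 - ‖f s‖ ^ 2| := abs_sub _ _
    _ ≤ 18 * η := by linarith

theorem exists_mul_le_of_integrableOn_Ioi {H : ℝ → ℝ} (hH : IntegrableOn H (Set.Ioi 0))
    {ε R : ℝ} (hε : 0 < ε) (hR : 0 ≤ R) : ∃ r > R, r * H r ≤ ε := by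
  by_contra! h
  refine not_integrableOn_Ioi_inv (a := R) ?_
  have hHR : IntegrableOn (fun r => H r / ε) (Set.Ioi R) :=
    (hH.mono_set (Set.Ioi_subset_Ioi hR)).div_const ε
  refine Integrable.mono' hHR measurable_inv.aestronglyMeasurable ?_
  filter_upwards [ae_restrict_mem measurableSet_Ioi] with r hr
  have hr0 : 0 < r := hR.trans_lt hr
  rw [Real.norm_of_nonneg (inv_nonneg.2 hr0.le), inv_eq_one_div, div_le_div_iff₀ hr0 hε]
  linarith [h r hr]

/-- The coefficient in direction `v` of the complex 1-form `f̄ D f - iA - d(f - w)/(f - w)`, where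
`A v = a`. -/
noncomputable def vortexForm (a : ℂ → ℝ) (f : ℂ → ℂ) (w v z : ℂ) : ℂ :=
  starRingEnd ℂ (f z) * (fderiv ℝ f z v + Complex.I * (a z : ℂ) * f z) - Complex.I * (a z : ℂ)
    - fderiv ℝ f z v / (f z - w)

theorem contDiff_vortexForm {a : ℂ → ℝ} {f : ℂ → ℂ} {w : ℂ} (v : ℂ) (ha : ContDiff ℝ 1 a)
    (hf : ContDiff ℝ 2 f) (hw : ∀ z, f z - w ≠ 0) : ContDiff ℝ 1 (vortexForm a f w v) := by
  have hf1 : ContDiff ℝ 1 f := hf.of_le one_le_two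
  have hfv : ContDiff ℝ 1 (fun z => fderiv ℝ f z v) :=
    (hf.fderiv_right (by norm_num)).clm_apply contDiff_const
  have hac : ContDiff ℝ 1 (fun z => Complex.I * (a z : ℂ)) :=
    contDiff_const.mul (Complex.ofRealCLM.contDiff.comp ha)
  have hconj : ContDiff ℝ 1 (fun z => starRingEnd ℂ (f z)) :=
    Complex.conjCLE.contDiff.comp hf1
  unfold vortexForm
  simp only [div_eq_mul_inv]
  exact ((hconj.mul (hfv.add (hac.mul hf1))).sub hac).sub
    (hfv.mul ((hf1.sub contDiff_const).inv hw))

theorem fderiv_vortexForm {a : ℂ → ℝ} {f : ℂ → ℂ} {w : ℂ} (u v z : ℂ) (ha : ContDiff ℝ 1 a)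
    (hf : ContDiff ℝ 2 f) (hw : ∀ z, f z - w ≠ 0) :
    fderiv ℝ (vortexForm a f w v) z u =
      starRingEnd ℂ (fderiv ℝ f z u) * (fderiv ℝ f z v + Complex.I * (a z : ℂ) * f z)
      + starRingEnd ℂ (f z) * (fderiv ℝ (fderiv ℝ f) z u v
        + (Complex.I * (fderiv ℝ a z u : ℂ) * f z + Complex.I * (a z : ℂ) * fderiv ℝ f z u))
      - Complex.I * (fderiv ℝ a z u : ℂ)
      - (fderiv ℝ (fderiv ℝ f) z u v * (f z - w) - fderiv ℝ f z v * fderiv ℝ f z u)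
        / (f z - w) ^ 2 := by
  have line {E : Type} [NormedAddCommGroup E] [NormedSpace ℝ E] {g : ℂ → E}
      (hg : ContDiff ℝ 1 g) : HasDerivAt (fun t : ℝ => g (z + t • u)) (fderiv ℝ g z u) 0 :=
    (hg.differentiable one_ne_zero z).hasFDerivAt.hasLineDerivAt u
  have hdf : ContDiff ℝ 1 (fderiv ℝ f) := hf.fderiv_right (by norm_num)
  have h1 := line (hf.of_le one_le_two)
  have h2 : HasDerivAt (fun t : ℝ => fderiv ℝ f (z + t • u) v) (fderiv ℝ (fderiv ℝ f) z u v) 0 := by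
    simpa using (line hdf).clm_apply (hasDerivAt_const (0 : ℝ) v)
  have h3 := (line ha).ofReal_comp.const_mul Complex.I
  have h := (((h1.star.mul (h2.add (h3.mul h1))).sub h3)).sub
    (h2.div (h1.sub_const w) (by simpa using hw z))
  refine ((line (contDiff_vortexForm v ha hf hw)).unique h).trans ?_
  simp

theorem curl_vortexForm {φ ψ : ℂ → ℝ} {f : ℂ → ℂ} {w : ℂ}
    (hφ : ContDiff ℝ 1 φ) (hψ : ContDiff ℝ 1 ψ) (hf : ContDiff ℝ 2 f) (hw : ∀ z, f z - w ≠ 0)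
    (heq1 : ∀ z : ℂ, (fderiv ℝ f z 1 + Complex.I * (φ z : ℂ) * f z)
      + Complex.I * (fderiv ℝ f z Complex.I + Complex.I * (ψ z : ℂ) * f z) = 0)
    (heq2 : ∀ z : ℂ, fderiv ℝ ψ z 1 - fderiv ℝ φ z Complex.I + (1 - ‖f z‖ ^ 2) / 2 = 0) (z : ℂ) :
    fderiv ℝ (vortexForm ψ f w Complex.I) z 1 - fderiv ℝ (vortexForm φ f w 1) z Complex.I
      = 2 * Complex.I * (glEnergyDensity φ ψ f z : ℂ) := by
  rw [fderiv_vortexForm 1 Complex.I z hψ hf hw, fderiv_vortexForm Complex.I 1 z hφ hf hw]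
  have hsymm : fderiv ℝ (fderiv ℝ f) z 1 Complex.I = fderiv ℝ (fderiv ℝ f) z Complex.I 1 :=
    (hf.contDiffAt.isSymmSndFDerivAt (by simp)).eq 1 Complex.I
  rw [hsymm]
  have hF : fderiv ℝ ψ z 1 - fderiv ℝ φ z Complex.I = -((1 - ‖f z‖ ^ 2) / 2) := by
    linarith [heq2 z]
  have hFc : (fderiv ℝ ψ z 1 : ℂ) = (fderiv ℝ φ z Complex.I : ℂ) - ((1 - ‖f z‖ ^ 2) / 2) := by
    have : fderiv ℝ ψ z 1 = fderiv ℝ φ z Complex.I - ((1 - ‖f z‖ ^ 2) / 2) := by linarith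
    rw [this]; push_cast; ring
  have hX : fderiv ℝ f z 1 + Complex.I * (φ z : ℂ) * f z
      = -Complex.I * (fderiv ℝ f z Complex.I + Complex.I * (ψ z : ℂ) * f z) := by
    linear_combination heq1 z
  set Y := fderiv ℝ f z Complex.I + Complex.I * (ψ z : ℂ) * f z with hY
  have hft : fderiv ℝ f z Complex.I = Y - Complex.I * (ψ z : ℂ) * f z := by rw [hY]; ring
  have hfs : fderiv ℝ f z 1 = -Complex.I * Y - Complex.I * (φ z : ℂ) * f z := by
    rw [← hX]; ring
  have hE : (glEnergyDensity φ ψ f z : ℂ)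
      = Y * starRingEnd ℂ Y + ((1 - f z * starRingEnd ℂ (f z)) / 2) ^ 2 := by
    rw [glEnergyDensity, hF, hX, ← hY, norm_mul, norm_neg, Complex.norm_I, Complex.mul_conj',
      Complex.mul_conj']
    push_cast
    ring
  rw [hE, hFc, ← Complex.mul_conj' (f z), hfs, hft]
  simp only [map_sub, map_mul, map_neg, Complex.conj_I, Complex.conj_ofReal]
  have h0 := hw z
  field_simp
  ring_nf

/-- Integration over `ℂ` by circles, for a nonnegative continuous function. -/
theorem integrableOn_circleIntegral_and_integral_eq {e : ℂ → ℝ} (he : Continuous e)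
    (he0 : ∀ z, 0 ≤ e z) (hfin : ∫⁻ z : ℂ, ENNReal.ofReal (e z) < ⊤) :
    IntegrableOn (fun r : ℝ => ∫ θ in (-Real.pi)..Real.pi, r * e (circleMap 0 r θ)) (Set.Ioi 0) ∧
    ∫ r in Set.Ioi (0 : ℝ), ∫ θ in (-Real.pi)..Real.pi, r * e (circleMap 0 r θ) = ∫ z, e z := by
  have hpolar (p : ℝ × ℝ) : Complex.polarCoord.symm p = circleMap 0 p.1 p.2 := by
    rw [Complex.polarCoord_symm_apply, circleMap_zero, Complex.exp_mul_I]
    push_cast; rfl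
  have hc : Continuous (fun p : ℝ × ℝ => p.1 * e (circleMap 0 p.1 p.2)) :=
    continuous_fst.mul (he.comp (contDiff_circleMap_zero (n := 0)).continuous)
  have htarget : polarCoord.target = Set.Ioi (0 : ℝ) ×ˢ Set.Ioo (-Real.pi) Real.pi := rfl
  have hintg : IntegrableOn (fun p : ℝ × ℝ => p.1 * e (circleMap 0 p.1 p.2))
      (Set.Ioi (0 : ℝ) ×ˢ Set.Ioo (-Real.pi) Real.pi) := by
    refine ⟨hc.aestronglyMeasurable, ?_⟩
    rw [hasFiniteIntegral_iff_ofReal]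
    · rw [← Complex.lintegral_comp_polarCoord_symm, htarget] at hfin
      refine lt_of_eq_of_lt (setLIntegral_congr_fun
        (measurableSet_Ioi.prod measurableSet_Ioo) fun p hp => ?_) hfin
      simp only [hpolar, smul_eq_mul]
      exact ENNReal.ofReal_mul (le_of_lt hp.1)
    · filter_upwards [ae_restrict_mem (measurableSet_Ioi.prod measurableSet_Ioo)] with p hp
      exact mul_nonneg (le_of_lt hp.1) (he0 _)
  have hI (r : ℝ) : ∫ θ in (-Real.pi)..Real.pi, r * e (circleMap 0 r θ)
      = ∫ θ in Set.Ioo (-Real.pi) Real.pi, r * e (circleMap 0 r θ) := by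
    rw [intervalIntegral.integral_of_le (by linarith [Real.pi_pos]), integral_Ioc_eq_integral_Ioo]
  simp only [hI]
  rw [Measure.volume_eq_prod] at hintg
  refine ⟨?_, ?_⟩
  · rw [IntegrableOn, ← Measure.prod_restrict] at hintg
    exact hintg.integral_prod_left
  · rw [← Complex.integral_comp_polarCoord_symm, htarget, Measure.volume_eq_prod]
    simp only [hpolar, smul_eq_mul]
    exact (setIntegral_prod _ hintg).symm

theorem glEnergyDensity_nonneg (φ ψ : ℂ → ℝ) (f : ℂ → ℂ) (z : ℂ) :
    0 ≤ glEnergyDensity φ ψ f z := by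
  unfold glEnergyDensity
  positivity

theorem continuous_glEnergyDensity {φ ψ : ℂ → ℝ} {f : ℂ → ℂ} (hφ : ContDiff ℝ 1 φ)
    (hψ : ContDiff ℝ 1 ψ) (hf : ContDiff ℝ 1 f) : Continuous (glEnergyDensity φ ψ f) := by
  have h1 := hφ.continuous_fderiv one_ne_zero
  have h2 := hψ.continuous_fderiv one_ne_zero
  have h3 := hf.continuous_fderiv one_ne_zero
  have h4 := hφ.continuous
  have h5 := hψ.continuous
  have h6 := hf.continuous
  unfold glEnergyDensity
  fun_prop

/-- On a circle carrying little energy, the energy inside is small if `f` omits the value `w`. -/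
theorem integral_energy_disc_le {φ ψ : ℂ → ℝ} {f : ℂ → ℂ} {w : ℂ} {η R : ℝ}
    (hφ : ContDiff ℝ 1 φ) (hψ : ContDiff ℝ 1 ψ) (hf : ContDiff ℝ 2 f) (hw : ∀ z, f z - w ≠ 0)
    (heq1 : ∀ z : ℂ, (fderiv ℝ f z 1 + Complex.I * (φ z : ℂ) * f z)
      + Complex.I * (fderiv ℝ f z Complex.I + Complex.I * (ψ z : ℂ) * f z) = 0)
    (heq2 : ∀ z : ℂ, fderiv ℝ ψ z 1 - fderiv ℝ φ z Complex.I + (1 - ‖f z‖ ^ 2) / 2 = 0)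
    (hη : 0 < η) (hη1 : 18 * η ≤ 3 / 4) (hηw : 18 * η < 1 - ‖w‖ ^ 2) (hR : 1 ≤ R)
    (henergy : R * ∫ θ in (-Real.pi)..Real.pi, R * glEnergyDensity φ ψ f (circleMap 0 R θ)
      ≤ η ^ 2) :
    ∫ r in (0 : ℝ)..R, ∫ θ in (-Real.pi)..Real.pi,
      r * glEnergyDensity φ ψ f (circleMap 0 r θ) ≤ 90 * η := by
  have hf1 : ContDiff ℝ 1 f := hf.of_le one_le_two
  have hpi := Real.pi_pos
  have hle : -Real.pi ≤ Real.pi := by linarith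
  have hcirc : Continuous (circleMap 0 R) := continuous_circleMap 0 R
  set X : ℝ → ℂ := fun θ => fderiv ℝ f (circleMap 0 R θ) 1
    + Complex.I * (φ (circleMap 0 R θ) : ℂ) * f (circleMap 0 R θ) with hX
  set Y : ℝ → ℂ := fun θ => fderiv ℝ f (circleMap 0 R θ) Complex.I
    + Complex.I * (ψ (circleMap 0 R θ) : ℂ) * f (circleMap 0 R θ) with hY
  set F : ℝ → ℂ := fun θ => f (circleMap 0 R θ) with hF
  set D : ℝ → ℂ := fun θ => -((R * Real.sin θ : ℝ) : ℂ) * X θ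
    + ((R * Real.cos θ : ℝ) : ℂ) * Y θ with hD
  set α : ℝ → ℝ := fun θ => -(R * Real.sin θ) * φ (circleMap 0 R θ)
    + (R * Real.cos θ) * ψ (circleMap 0 R θ) with hα
  set e : ℝ → ℝ := fun θ => glEnergyDensity φ ψ f (circleMap 0 R θ) with he
  have hec : Continuous e := (continuous_glEnergyDensity hφ hψ hf1).comp hcirc
  have hfd := (hf.continuous_fderiv two_ne_zero).comp hcirc
  have hFc : Continuous F := hf.continuous.comp hcirc
  have hφc : Continuous fun θ => φ (circleMap 0 R θ) := hφ.continuous.comp hcirc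
  have hψc : Continuous fun θ => ψ (circleMap 0 R θ) := hψ.continuous.comp hcirc
  have hXc : Continuous X := (hfd.clm_apply continuous_const).add
    ((continuous_const.mul (Complex.continuous_ofReal.comp hφc)).mul hFc)
  have hYc : Continuous Y := (hfd.clm_apply continuous_const).add
    ((continuous_const.mul (Complex.continuous_ofReal.comp hψc)).mul hFc)
  have hDc : Continuous D := by fun_prop
  have hαc : Continuous α := by fun_prop
  have hFderiv : ∀ θ, HasDerivAt F (D θ - Complex.I * α θ * F θ) θ := by
    intro θ
    refine (hasDerivAt_comp_circleMap hf1 R θ).congr_deriv ?_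
    simp only [hD, hα, hX, hY, hF]
    push_cast
    ring
  have heη : ∫ θ in (-Real.pi)..Real.pi, R ^ 2 * e θ ≤ η ^ 2 := by
    rw [← intervalIntegral.integral_const_mul] at henergy
    refine le_trans (le_of_eq ?_) henergy
    congr 1; ext θ; ring
  have hDe : ∀ θ, ‖D θ‖ ^ 2 ≤ 2 * (R ^ 2 * e θ) := by
    intro θ
    have h1 : ‖D θ‖ ≤ R * (|Real.sin θ| * ‖X θ‖ + |Real.cos θ| * ‖Y θ‖) := by
      refine (norm_add_le _ _).trans (le_of_eq ?_)
      rw [norm_mul, norm_mul, norm_neg, Complex.norm_real, Complex.norm_real, norm_mul, norm_mul,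
        Real.norm_of_nonneg (by linarith : 0 ≤ R), Real.norm_eq_abs, Real.norm_eq_abs]
      ring
    have h2 : ‖X θ‖ ^ 2 + ‖Y θ‖ ^ 2 ≤ 2 * e θ := by
      simp only [he, glEnergyDensity, hX, hY]
      have h3 := sq_nonneg (fderiv ℝ ψ (circleMap 0 R θ) 1 - fderiv ℝ φ (circleMap 0 R θ) Complex.I)
      have h4 := sq_nonneg ((1 - ‖f (circleMap 0 R θ)‖ ^ 2) / 2)
      linarith
    have hcs : |Real.sin θ| ^ 2 + |Real.cos θ| ^ 2 = 1 := by
      rw [sq_abs, sq_abs]; exact Real.sin_sq_add_cos_sq θ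
    have h3 : (|Real.sin θ| * ‖X θ‖ + |Real.cos θ| * ‖Y θ‖) ^ 2 ≤ ‖X θ‖ ^ 2 + ‖Y θ‖ ^ 2 := by
      calc _ = (|Real.sin θ| ^ 2 + |Real.cos θ| ^ 2) * (‖X θ‖ ^ 2 + ‖Y θ‖ ^ 2)
            - (|Real.sin θ| * ‖Y θ‖ - |Real.cos θ| * ‖X θ‖) ^ 2 := by ring
        _ ≤ _ := by
          rw [hcs]
          linarith [sq_nonneg (|Real.sin θ| * ‖Y θ‖ - |Real.cos θ| * ‖X θ‖)]
    calc ‖D θ‖ ^ 2 ≤ (R * (|Real.sin θ| * ‖X θ‖ + |Real.cos θ| * ‖Y θ‖)) ^ 2 :=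
          pow_le_pow_left₀ (norm_nonneg _) h1 2
      _ = R ^ 2 * (|Real.sin θ| * ‖X θ‖ + |Real.cos θ| * ‖Y θ‖) ^ 2 := by ring
      _ ≤ R ^ 2 * (2 * e θ) := mul_le_mul_of_nonneg_left (h3.trans h2) (sq_nonneg R)
      _ = 2 * (R ^ 2 * e θ) := by ring
  have hFe : ∀ θ, (1 - ‖F θ‖ ^ 2) ^ 2 ≤ 8 * (R ^ 2 * e θ) := by
    intro θ
    have h1 : (1 - ‖F θ‖ ^ 2) ^ 2 ≤ 8 * e θ := by
      simp only [he, glEnergyDensity, hF]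
      have h3 := sq_nonneg (fderiv ℝ ψ (circleMap 0 R θ) 1 - fderiv ℝ φ (circleMap 0 R θ) Complex.I)
      have h4 := sq_nonneg ‖fderiv ℝ f (circleMap 0 R θ) 1
        + Complex.I * (φ (circleMap 0 R θ) : ℂ) * f (circleMap 0 R θ)‖
      have h5 := sq_nonneg ‖fderiv ℝ f (circleMap 0 R θ) Complex.I
        + Complex.I * (ψ (circleMap 0 R θ) : ℂ) * f (circleMap 0 R θ)‖
      linarith
    have h2 : 0 ≤ e θ := glEnergyDensity_nonneg _ _ _ _
    have h3 := mul_le_mul_of_nonneg_right (one_le_pow₀ hR (n := 2)) h2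
    linarith
  have hDη : ∫ θ in (-Real.pi)..Real.pi, ‖D θ‖ ^ 2 ≤ 2 * η ^ 2 := by
    refine (intervalIntegral.integral_mono_on hle (Continuous.intervalIntegrable (by fun_prop) _ _)
      (Continuous.intervalIntegrable (by fun_prop) _ _) fun θ _ => hDe θ).trans ?_
    rw [intervalIntegral.integral_const_mul]
    linarith
  have hFη : ∫ θ in (-Real.pi)..Real.pi, (1 - ‖F θ‖ ^ 2) ^ 2 ≤ 8 * η ^ 2 := by
    refine (intervalIntegral.integral_mono_on hle (Continuous.intervalIntegrable (by fun_prop) _ _)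
      (Continuous.intervalIntegrable (by fun_prop) _ _) fun θ _ => hFe θ).trans ?_
    rw [intervalIntegral.integral_const_mul]
    linarith
  have hclose := abs_one_sub_norm_sq_le hη (by linarith) hDc hFderiv hDη hFη
  have hhalf : ∀ θ ∈ Set.Icc (-Real.pi) Real.pi, 1 / 2 ≤ ‖F θ‖ := by
    intro θ hθ
    have := (abs_le.1 (hclose θ hθ)).2
    nlinarith [norm_nonneg (F θ)]
  have hgt : ∀ θ ∈ Set.Icc (-Real.pi) Real.pi, ‖w‖ < ‖F θ‖ := by
    intro θ hθ
    have := (abs_le.1 (hclose θ hθ)).2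
    refine lt_of_pow_lt_pow_left₀ 2 (norm_nonneg _) ?_
    linarith
  have hper : F (-Real.pi) = F Real.pi := by
    have := periodic_circleMap 0 R (-Real.pi)
    simp only [hF, ← this]
    ring_nf
  have hlog := integral_div_sub_sub_div_eq_zero hFderiv (by fun_prop) hper
    (by rwa [Set.uIcc_of_le hle])
  have hgreen := integral_curl_polar (contDiff_vortexForm (w := w) 1 hφ hf hw)
    (contDiff_vortexForm Complex.I hψ hf hw) R
  simp only [curl_vortexForm hφ hψ hf hw heq1 heq2] at hgreen
  have hlhs : ∫ r in (0 : ℝ)..R, ∫ θ in (-Real.pi)..Real.pi,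
      (r : ℂ) * (2 * Complex.I * (glEnergyDensity φ ψ f (circleMap 0 r θ) : ℂ))
      = 2 * Complex.I * ((∫ r in (0 : ℝ)..R, ∫ θ in (-Real.pi)..Real.pi,
        r * glEnergyDensity φ ψ f (circleMap 0 r θ) : ℝ) : ℂ) := by
    rw [← intervalIntegral.integral_ofReal, ← intervalIntegral.integral_const_mul]
    congr 1; ext r
    rw [← intervalIntegral.integral_ofReal, ← intervalIntegral.integral_const_mul]
    congr 1; ext θ
    push_cast; ring
  set G : ℝ → ℂ := fun θ => (R : ℂ) *
      (-(Real.sin θ : ℂ) * vortexForm φ f w 1 (circleMap 0 R θ)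
        + (Real.cos θ : ℂ) * vortexForm ψ f w Complex.I (circleMap 0 R θ)) with hG
  have hGc : Continuous G := by
    have h1 := (contDiff_vortexForm (w := w) 1 hφ hf hw).continuous.comp hcirc
    have h2 := (contDiff_vortexForm (w := w) Complex.I hψ hf hw).continuous.comp hcirc
    simp only [Function.comp_def] at h1 h2
    fun_prop
  set L : ℝ → ℂ := fun θ => (D θ - Complex.I * α θ * F θ) / (F θ - w)
    - (D θ - Complex.I * α θ * F θ) / F θ with hL
  have hLi : IntervalIntegrable L volume (-Real.pi) Real.pi := by
    refine ContinuousOn.intervalIntegrable (ContinuousOn.sub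
      (Continuous.continuousOn (Continuous.div (by fun_prop) (by fun_prop) fun θ => hw _))
      (ContinuousOn.div (by fun_prop) (by fun_prop) ?_))
    intro θ hθ
    rw [Set.uIcc_of_le hle] at hθ
    exact norm_pos_iff.1 (by linarith [hhalf θ hθ])
  have hGL : ∫ θ in (-Real.pi)..Real.pi, G θ = ∫ θ in (-Real.pi)..Real.pi, (G θ + L θ) := by
    rw [intervalIntegral.integral_add (hGc.intervalIntegrable _ _) hLi, hlog, add_zero]
  have hbound : ∀ θ ∈ Set.Icc (-Real.pi) Real.pi, ‖G θ + L θ‖ ≤ 18 * η * (1 + ‖D θ‖ ^ 2) := by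
    intro θ hθ
    have hF0 : F θ ≠ 0 := norm_pos_iff.1 (by linarith [hhalf θ hθ])
    have hFw : F θ - w ≠ 0 := hw _
    have hGLeq : G θ + L θ = (F θ * starRingEnd ℂ (F θ) - 1) / F θ * D θ := by
      have hGeq : G θ = starRingEnd ℂ (F θ) * D θ - Complex.I * α θ
          - (D θ - Complex.I * α θ * F θ) / (F θ - w) := by
        simp only [hG, vortexForm, hD, hα, hX, hY, hF]
        push_cast
        ring
      rw [hGeq]
      simp only [hL]
      field_simp
      ring
    have hnum : ‖F θ * starRingEnd ℂ (F θ) - 1‖ ≤ 18 * η := by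
      rw [Complex.mul_conj']
      have : ((‖F θ‖ : ℂ) ^ 2 - 1) = ((‖F θ‖ ^ 2 - 1 : ℝ) : ℂ) := by push_cast; ring
      rw [this, Complex.norm_real, Real.norm_eq_abs, abs_sub_comm]
      exact hclose θ hθ
    rw [hGLeq, norm_mul, norm_div]
    have h1 : ‖F θ * starRingEnd ℂ (F θ) - 1‖ / ‖F θ‖ ≤ 36 * η := by
      rw [div_le_iff₀ (by linarith [hhalf θ hθ])]
      nlinarith [hhalf θ hθ]
    calc _ ≤ 36 * η * ‖D θ‖ := mul_le_mul_of_nonneg_right h1 (norm_nonneg _)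
      _ ≤ _ := by nlinarith [mul_nonneg hη.le (sq_nonneg (1 - ‖D θ‖))]
  have hnorm : ‖∫ θ in (-Real.pi)..Real.pi, (G θ + L θ)‖
      ≤ ∫ θ in (-Real.pi)..Real.pi, 18 * η * (1 + ‖D θ‖ ^ 2) :=
    intervalIntegral.norm_integral_le_of_norm_le hle
      (Filter.Eventually.of_forall fun θ hθ => hbound θ (Set.Ioc_subset_Icc_self hθ))
      (Continuous.intervalIntegrable (by fun_prop) _ _)
  rw [← hGL, ← hgreen, hlhs, norm_mul, norm_mul, Complex.norm_I, Complex.norm_real,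
    intervalIntegral.integral_const_mul, intervalIntegral.integral_add
      (continuous_const.intervalIntegrable _ _) (Continuous.intervalIntegrable (by fun_prop) _ _),
    intervalIntegral.integral_const, smul_eq_mul] at hnorm
  have h3 := (le_abs_self _).trans_eq (Real.norm_eq_abs (∫ r in (0 : ℝ)..R,
    ∫ θ in (-Real.pi)..Real.pi, r * glEnergyDensity φ ψ f (circleMap 0 r θ))).symm
  have h4 : 18 * η * ((Real.pi - -Real.pi) * 1 + ∫ θ in (-Real.pi)..Real.pi, ‖D θ‖ ^ 2)
      ≤ 18 * η * 10 := by
    refine mul_le_mul_of_nonneg_left ?_ (by positivity)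
    nlinarith [Real.pi_lt_d2]
  norm_num at hnorm h3 h4 ⊢
  linarith

/-- Let `(φ, ψ, f)` be a vortex over `ℂ` in the Ginzburg–Landau setting, i.e. smooth functions
`φ, ψ : ℂ → ℝ`, `f : ℂ → ℂ` satisfying `∂ₛf + iφf + i(∂ₜf + iψf) = 0` and
`∂ₛψ - ∂ₜφ + (1 - |f|²)/2 = 0`, whose energy `E = ∫_ℂ e` is finite and positive. Then
`|f(z)| < 1` for every `z ∈ ℂ`. -/
theorem vortex_image_contains_unit_ball (φ ψ : ℂ → ℝ) (f : ℂ → ℂ)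
    (hφ : ContDiff ℝ (⊤ : ℕ∞) φ) (hψ : ContDiff ℝ (⊤ : ℕ∞) ψ) (hf : ContDiff ℝ (⊤ : ℕ∞) f)
    (heq1 : ∀ z : ℂ, (fderiv ℝ f z 1 + Complex.I * (φ z : ℂ) * f z)
      + Complex.I * (fderiv ℝ f z Complex.I + Complex.I * (ψ z : ℂ) * f z) = 0)
    (heq2 : ∀ z : ℂ, fderiv ℝ ψ z 1 - fderiv ℝ φ z Complex.I + (1 - ‖f z‖ ^ 2) / 2 = 0)
    (hfin : ∫⁻ z : ℂ, ENNReal.ofReal (glEnergyDensity φ ψ f z) < ⊤)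
    (hpos : 0 < ∫⁻ z : ℂ, ENNReal.ofReal (glEnergyDensity φ ψ f z)) :
    ∀ w : ℂ, ‖w‖ < 1 → ∃ z : ℂ, f z = w := by
  intro w hw
  by_contra! hne
  have hφ1 : ContDiff ℝ 1 φ := contDiff_infty.1 hφ 1
  have hψ1 : ContDiff ℝ 1 ψ := contDiff_infty.1 hψ 1
  have hf2 : ContDiff ℝ 2 f := contDiff_infty.1 hf 2
  have hec := continuous_glEnergyDensity hφ1 hψ1 (hf2.of_le one_le_two)
  have he0 := glEnergyDensity_nonneg φ ψ f
  obtain ⟨hintg, heq⟩ := integrableOn_circleIntegral_and_integral_eq hec he0 hfin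
  set H : ℝ → ℝ := fun r => ∫ θ in (-Real.pi)..Real.pi,
    r * glEnergyDensity φ ψ f (circleMap 0 r θ)
  have hH0 : ∀ r ∈ Set.Ioi (0 : ℝ), 0 ≤ H r := fun r hr =>
    intervalIntegral.integral_nonneg (by linarith [Real.pi_pos])
      fun θ _ => mul_nonneg (le_of_lt hr) (he0 _)
  have hE : 0 < ∫ r in Set.Ioi (0 : ℝ), H r := by
    rw [heq, integral_eq_lintegral_of_nonneg_ae (Filter.Eventually.of_forall he0)
      hec.aestronglyMeasurable]
    exact ENNReal.toReal_pos hpos.ne' hfin.ne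
  have hlim := intervalIntegral_tendsto_integral_Ioi 0 hintg Filter.tendsto_id
  obtain ⟨R₀, hR₀⟩ := Filter.eventually_atTop.1 (hlim.eventually (lt_mem_nhds (half_lt_self hE)))
  set E := ∫ r in Set.Ioi (0 : ℝ), H r
  have hw2 : 0 < 1 - ‖w‖ ^ 2 := by nlinarith [norm_nonneg w]
  obtain ⟨η, hη, hη1, hηw, hηE⟩ : ∃ η : ℝ, 0 < η ∧ 18 * η ≤ 3 / 4 ∧ 18 * η < 1 - ‖w‖ ^ 2 ∧
      90 * η ≤ E / 2 := by
    refine ⟨min (1 / 24) (min ((1 - ‖w‖ ^ 2) / 36) (E / 180)), by positivity, ?_, ?_, ?_⟩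
    · linarith [min_le_left (1 / 24) (min ((1 - ‖w‖ ^ 2) / 36) (E / 180))]
    · linarith [(min_le_right (1 / 24) (min ((1 - ‖w‖ ^ 2) / 36) (E / 180))).trans
        (min_le_left _ _)]
    · linarith [(min_le_right (1 / 24) (min ((1 - ‖w‖ ^ 2) / 36) (E / 180))).trans
        (min_le_right _ _)]
  obtain ⟨R, hR, hRη⟩ := exists_mul_le_of_integrableOn_Ioi hintg (pow_pos hη 2)
    (zero_le_one.trans (le_max_right R₀ 1))
  have hR1 : 1 ≤ R := (le_max_right _ _).trans hR.le
  have hlow := hR₀ R ((le_max_left _ _).trans hR.le)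
  have hup := integral_energy_disc_le hφ1 hψ1 hf2 (fun z => sub_ne_zero.2 (hne z)) heq1 heq2
    hη hη1 hηw hR1 hRη
  exact absurd (hlow.trans_le (hup.trans hηE)) (lt_irrefl _)
end
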